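/- Under Hypothesis H, with Z and ℓ as in the context, the value at s = −ℓ of the analytic continuation of the zeta integral satisfies 𝒵_{N,n}(−ℓ, w, M) = [(−1)^N (ℓ!)^n / Π_{j=0}^{Z} (n − j)] · Σ_{γ ∈ I_{Z+1}^n} Σ_{q=0}^{nℓ+N} [(−1)^q (w_1^γ)^{nℓ+N−q} / (nℓ+N−q)!] · D^{(q)}_{ℓ,M^γ,Z}(g_{w'^γ, M^γ, Z}), where w_1^γ := w_{γ(1)}, w'^γ := (w_{γ(2)},…,w_{γ(n)}), and M^γ := (a_{iγ(j)}). -/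

import Mathlib

open MeasureTheory Complex
open scoped Classical

noncomputable section

/-- Hypothesis H: each entry of the matrix either vanishes or has positive real part,
and no row vanishes. -/
def HypH {N n : ℕ} (a : Fin N → Fin n → ℂ) : Prop :=
  (∀ i j, a i j = 0 ∨ 0 < (a i j).re) ∧ ∀ i, ∃ j, a i j ≠ 0

/-- The Shintani–Barnes zeta integral `𝒵_{N,n}(s,w,M)`. -/
def zetaIntegral {N n : ℕ} (a : Fin N → Fin n → ℂ) (s : ℂ) (w : Fin n → ℂ) : ℂ :=
  ∫ t in {t : Fin N → ℝ | ∀ i, 0 < t i}, ∏ j, (w j + ∑ i, (t i : ℂ) * a i j) ^ (-s)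

/-- `F_j(M)`: rows starting with exactly `j` zeroes (0-based `j`). -/
def Fj {N n : ℕ} (a : Fin N → Fin n → ℂ) (j : Fin n) : Finset (Fin N) :=
  Finset.univ.filter fun i => (∀ k : Fin n, (k : ℕ) < (j : ℕ) → a i k = 0) ∧ a i j ≠ 0

/-- The exponents `α_j` (0-based `j`; the paper's `α_j` is our `alphav (j-1)`):
`α_j = (n-j)ℓ + Σ_{k=j}^{Z} |F_k|` for `j ≤ Z`, and `α_j = ℓ` otherwise. -/
def alphav {N n : ℕ} (a : Fin N → Fin n → ℂ) (Z l : ℕ) (j : Fin n) : ℕ :=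
  if (j : ℕ) ≤ Z then
    (n - (j : ℕ)) * l +
      ∑ k ∈ Finset.univ.filter (fun k : Fin n => (j : ℕ) ≤ (k : ℕ) ∧ (k : ℕ) ≤ Z),
        (Fj a k).card
  else l

/-- Partial derivative in the `j`-th coordinate. -/
def pder {m : ℕ} (j : Fin m) (h : (Fin m → ℂ) → ℂ) : (Fin m → ℂ) → ℂ :=
  fun σ => fderiv ℂ h σ (Pi.single j 1)

/-- Iterated mixed partial derivative `∂^{β}`. -/
def mder {m : ℕ} (β : Fin m → ℕ) (h : (Fin m → ℂ) → ℂ) : (Fin m → ℂ) → ℂ :=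
  (List.finRange m).foldr (fun j acc => (pder j)^[β j] acc) h

/-- The functional `D^{(q)}_{ℓ,M,Z}(h)`: the mixed partial derivative of order
`q` in `σ_1` and `α_j` in `σ_j` (`j ≥ 2`), at `σ = 0`, divided by `q!·α_2!⋯α_n!`. -/
def Dq {N n : ℕ} (a : Fin N → Fin n → ℂ) (Z l q : ℕ) (h : (Fin n → ℂ) → ℂ) : ℂ :=
  (((q.factorial : ℂ) *
      ∏ j ∈ Finset.univ.filter (fun j : Fin n => (j : ℕ) ≠ 0), ((alphav a Z l j).factorial : ℂ)))⁻¹ *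
    mder (fun j => if (j : ℕ) = 0 then q else alphav a Z l j) h 0

/-- The function `y_{M,Z}(σ')`. -/
def yfun {N n : ℕ} (a : Fin N → Fin n → ℂ) (Z : ℕ) (σ : Fin n → ℂ) : ℂ :=
  ∏ j ∈ Finset.univ.filter (fun j : Fin n => (j : ℕ) ≤ Z), ∏ i ∈ Fj a j,
    (a i j +
      (∑ k ∈ Finset.univ.filter (fun k : Fin n => (j : ℕ) < (k : ℕ) ∧ (k : ℕ) ≤ Z),
        a i k * ∏ r ∈ Finset.univ.filter
          (fun r : Fin n => (j : ℕ) < (r : ℕ) ∧ (r : ℕ) ≤ (k : ℕ)), σ r) +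
      (∑ k ∈ Finset.univ.filter (fun k : Fin n => Z < (k : ℕ)), a i k * σ k) *
        ∏ r ∈ Finset.univ.filter (fun r : Fin n => (j : ℕ) < (r : ℕ) ∧ (r : ℕ) ≤ Z), σ r)

/-- The function `g_{w',M,Z}(σ)`. -/
def gfun {N n : ℕ} (a : Fin N → Fin n → ℂ) (Z : ℕ) (w : Fin n → ℂ) (σ : Fin n → ℂ) : ℂ :=
  ((∏ j ∈ Finset.univ.filter (fun j : Fin n => 1 ≤ (j : ℕ) ∧ (j : ℕ) ≤ Z),
      Complex.exp (-(w j) *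
        ∏ r ∈ Finset.univ.filter (fun r : Fin n => (r : ℕ) ≤ (j : ℕ)), σ r)) *
    ∏ m' ∈ Finset.univ.filter (fun m' : Fin n => Z < (m' : ℕ)),
      Complex.exp (-(w m') * σ m' *
        ∏ r ∈ Finset.univ.filter (fun r : Fin n => (r : ℕ) ≤ Z), σ r)) / yfun a Z σ

/-- The change of variables `T(σ)`. -/
def Tmap {n : ℕ} (Z : ℕ) (σ : Fin n → ℂ) : Fin n → ℂ := fun k =>
  if (k : ℕ) ≤ Z then ∏ r ∈ Finset.univ.filter (fun r : Fin n => (r : ℕ) ≤ (k : ℕ)), σ r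
  else σ k * ∏ r ∈ Finset.univ.filter (fun r : Fin n => (r : ℕ) ≤ Z), σ r

/-- `φ(z) = z/(1-e^{-z})`. -/
def phiFn (z : ℂ) : ℂ := z / (1 - Complex.exp (-z))

/-- `Φ(T) = Π_i φ(Σ_j a_{ij} T_j)`. -/
def PhiFn {N n : ℕ} (a : Fin N → Fin n → ℂ) (T : Fin n → ℂ) : ℂ :=
  ∏ i, phiFn (∑ j, a i j * T j)

/-- `g̃_{w',M,Z}(σ) = g_{w',M,Z}(σ) · Φ(T(σ))`. -/
def gtilde {N n : ℕ} (a : Fin N → Fin n → ℂ) (Z : ℕ) (w : Fin n → ℂ) (σ : Fin n → ℂ) : ℂ :=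
  gfun a Z w σ * PhiFn a (Tmap Z σ)

/-- `I_{Z+1}^n`: the injections of `{1,…,Z+1}` into `{1,…,n}`, realized as the
permutations of `Fin n` which are strictly increasing on the indices `≥ Z+1`. -/
def InZset (n Z : ℕ) : Finset (Equiv.Perm (Fin n)) :=
  Finset.univ.filter fun γ => ∀ i j : Fin n, Z + 1 ≤ (i : ℕ) → i < j → γ i < γ j

/-- A parametric integral of holomorphic functions, locally uniformly dominated, is holomorphic. -/
theorem differentiableOn_integral_of_dominated {α : Type*} [MeasurableSpace α] {μ : Measure α}
    {U : Set ℂ} (hU : IsOpen U) {f : ℂ → α → ℂ}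
    (hmeas : ∀ s ∈ U, AEStronglyMeasurable (f s) μ)
    (hdiff : ∀ᵐ a ∂μ, DifferentiableOn ℂ (fun s => f s a) U)
    (hbound : ∀ s₀ ∈ U, ∃ ε > 0, ∃ b : α → ℝ, Integrable b μ ∧
      ∀ᵐ a ∂μ, ∀ s ∈ Metric.ball s₀ ε, s ∈ U → ‖f s a‖ ≤ b a) :
    DifferentiableOn ℂ (fun s => ∫ a, f s a ∂μ) U := by
  intro s₀ hs₀
  obtain ⟨ε, hε, b, hb, hfb⟩ := hbound s₀ hs₀
  obtain ⟨ε', hε', hball⟩ := Metric.isOpen_iff.1 hU s₀ hs₀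
  set r := min ε ε' / 3 with hr
  have hmin : 0 < min ε ε' := lt_min hε hε'
  have hr0 : 0 < r := by positivity
  have hsub : ∀ s ∈ Metric.ball s₀ r, ∀ z ∈ Metric.closedBall s r,
      z ∈ Metric.ball s₀ ε ∧ z ∈ U := by
    intro s hs z hz
    have h1 : dist z s₀ < min ε ε' := by
      have := dist_triangle z s s₀
      rw [Metric.mem_ball] at hs
      rw [Metric.mem_closedBall] at hz
      linarith
    exact ⟨lt_of_lt_of_le h1 (min_le_left _ _),
      hball (lt_of_lt_of_le h1 (min_le_right _ _))⟩
  have hself : ∀ s ∈ Metric.ball s₀ r, s ∈ Metric.ball s₀ ε ∧ s ∈ U := fun s hs =>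
    hsub s hs s (Metric.mem_closedBall_self hr0.le)
  have hderiv : ∀ᵐ a ∂μ, ∀ s ∈ Metric.ball s₀ r,
      HasDerivAt (fun s => f s a) (deriv (fun s => f s a) s) s := by
    filter_upwards [hdiff] with a ha s hs
    exact (ha.differentiableAt (hU.mem_nhds (hself s hs).2)).hasDerivAt
  have hmeas' : AEStronglyMeasurable (fun a => deriv (fun s => f s a) s₀) μ := by
    have hlim : Filter.Tendsto (fun k : ℕ => r / ((k : ℝ) + 2)) Filter.atTop (nhds 0) :=
      Filter.Tendsto.const_div_atTop
        (Filter.tendsto_atTop_add_const_right _ _ tendsto_natCast_atTop_atTop) r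
    have hpos : ∀ k : ℕ, 0 < r / ((k : ℝ) + 2) := fun k => by positivity
    refine aestronglyMeasurable_of_tendsto_ae (u := Filter.atTop)
      (f := fun (k : ℕ) a => ((r / ((k : ℝ) + 2) : ℝ) : ℂ)⁻¹ •
        (f (s₀ + ((r / ((k : ℝ) + 2) : ℝ) : ℂ)) a - f s₀ a)) ?_ ?_
    · intro k
      refine AEStronglyMeasurable.const_smul (𝕜 := ℂ) (AEStronglyMeasurable.sub (hmeas _ ?_)
        (hmeas _ hs₀)) (((r / ((k : ℝ) + 2) : ℝ) : ℂ)⁻¹)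
      refine (hself _ ?_).2
      rw [Metric.mem_ball, dist_self_add_left, Complex.norm_real, Real.norm_of_nonneg (hpos k).le]
      rw [div_lt_iff₀ (by positivity)]
      nlinarith [(Nat.cast_nonneg k : (0 : ℝ) ≤ k)]
    · filter_upwards [hderiv] with a ha
      have h := (ha s₀ (Metric.mem_ball_self hr0)).tendsto_slope_zero
      refine h.comp ?_
      refine tendsto_nhdsWithin_iff.2 ⟨?_, Filter.Eventually.of_forall fun k => ?_⟩
      · have := (Complex.continuous_ofReal.tendsto 0).comp hlim
        simpa [Function.comp_def] using this
      · have := hpos k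
        simp only [Set.mem_compl_iff, Set.mem_singleton_iff, Complex.ofReal_eq_zero]
        exact this.ne'
  have hInt : Integrable (f s₀) μ := by
    refine hb.mono' (hmeas s₀ hs₀) ?_
    filter_upwards [hfb] with a ha
    exact ha s₀ (Metric.mem_ball_self hε) hs₀
  have key := hasDerivAt_integral_of_dominated_loc_of_deriv_le (μ := μ) (𝕜 := ℂ)
    (F := f) (F' := fun s a => deriv (fun s => f s a) s) (bound := fun a => b a / r)
    (Metric.ball_mem_nhds s₀ hr0)
    (Filter.eventually_of_mem (hU.mem_nhds hs₀) hmeas) hInt hmeas' ?_ (hb.div_const r) hderiv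
  · exact key.2.differentiableAt.differentiableWithinAt
  · filter_upwards [hdiff, hfb] with a ha hba s hs
    refine Complex.norm_deriv_le_of_forall_mem_sphere_norm_le hr0 ?_ ?_
    · refine DifferentiableOn.diffContOnCl (ha.mono ?_)
      refine (closure_minimal Metric.ball_subset_closedBall Metric.isClosed_closedBall).trans ?_
      exact fun z hz => (hsub s hs z hz).2
    · intro z hz
      have := hsub s hs z (Metric.sphere_subset_closedBall hz)
      exact hba z this.1 this.2

/-- Euler's integral with a complex rate. -/
theorem integral_cpow_mul_cexp_neg_mul_Ioi {s r : ℂ} (hs : 0 < s.re) (hr : 0 < r.re) :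
    ∫ t in Set.Ioi (0 : ℝ), (t : ℂ) ^ (s - 1) * Complex.exp (-(r * t)) =
      r ^ (-s) * Complex.Gamma s := by
  set U : Set ℂ := {z | 0 < z.re} with hUdef
  have hU : IsOpen U := isOpen_lt continuous_const Complex.continuous_re
  have hmeas : ∀ z ∈ U, AEStronglyMeasurable
      (fun t : ℝ => (t : ℂ) ^ (s - 1) * Complex.exp (-(z * t)))
      (volume.restrict (Set.Ioi (0 : ℝ))) := fun z _ => by
    refine Measurable.aestronglyMeasurable ?_
    fun_prop
  have hd : DifferentiableOn ℂ
      (fun z => ∫ t in Set.Ioi (0 : ℝ), (t : ℂ) ^ (s - 1) * Complex.exp (-(z * t))) U := by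
    refine differentiableOn_integral_of_dominated hU hmeas ?_ ?_
    · refine Filter.Eventually.of_forall fun t => ?_
      fun_prop
    · intro z₀ hz₀
      have hz₀' : 0 < z₀.re := hz₀
      refine ⟨z₀.re / 2, by positivity, fun t => t ^ (s.re - 1) * Real.exp (-(z₀.re / 2) * t),
        ?_, ?_⟩
      · have := integrableOn_rpow_mul_exp_neg_mul_rpow (s := s.re - 1) (p := 1) (b := z₀.re / 2)
          (by linarith) one_pos (by positivity)
        simpa using! this
      · filter_upwards [ae_restrict_mem measurableSet_Ioi] with t ht z hz _
        have ht' : 0 < t := ht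
        rw [norm_mul, Complex.norm_cpow_eq_rpow_re_of_pos ht', Complex.norm_exp]
        simp only [Complex.sub_re, Complex.one_re, Complex.neg_re, Complex.mul_re,
          Complex.ofReal_re, Complex.ofReal_im, mul_zero, sub_zero]
        gcongr
        have h1 : |(z - z₀).re| ≤ ‖z - z₀‖ := Complex.abs_re_le_norm _
        rw [Metric.mem_ball, dist_eq_norm] at hz
        have h2 := (abs_lt.1 (lt_of_le_of_lt h1 hz)).1
        simp only [Complex.sub_re] at h2
        nlinarith
  have ha := hd.analyticOnNhd hU
  have hb : AnalyticOnNhd ℂ (fun z => z ^ (-s) * Complex.Gamma s) U := by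
    refine DifferentiableOn.analyticOnNhd ?_ hU
    refine DifferentiableOn.mul_const ?_ _
    intro z hz
    refine (DifferentiableAt.cpow_const differentiableAt_id (Or.inl hz)).differentiableWithinAt
  have hconn : IsPreconnected U := (convex_halfSpace_re_gt 0).isPreconnected
  have h1 : (1 : ℂ) ∈ U := by simp [hUdef]
  refine ha.eqOn_of_preconnected_of_frequently_eq hb hconn h1 ?_ hr
  have hreal : ∀ x : ℝ, 0 < x →
      ∫ t in Set.Ioi (0 : ℝ), (t : ℂ) ^ (s - 1) * Complex.exp (-((x : ℂ) * t)) =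
      (x : ℂ) ^ (-s) * Complex.Gamma s := by
    intro x hx
    rw [Complex.integral_cpow_mul_exp_neg_mul_Ioi hs hx, one_div, Complex.inv_cpow,
      Complex.cpow_neg]
    rw [Complex.arg_ofReal_of_nonneg hx.le]
    exact Real.pi_pos.ne
  have htend : Filter.Tendsto (fun k : ℕ => ((1 + 1 / ((k : ℝ) + 1) : ℝ) : ℂ)) Filter.atTop
      (nhdsWithin 1 {1}ᶜ) := by
    refine tendsto_nhdsWithin_iff.2 ⟨?_, Filter.Eventually.of_forall fun k => ?_⟩
    · have h := (Complex.continuous_ofReal.tendsto _).comp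
        (tendsto_one_div_add_atTop_nhds_zero_nat (𝕜 := ℝ) |>.const_add 1)
      simpa [Function.comp_def] using h
    · have : (0 : ℝ) < 1 / ((k : ℝ) + 1) := by positivity
      simp only [Set.mem_compl_iff, Set.mem_singleton_iff]
      rw [← Complex.ofReal_one, Complex.ofReal_inj]
      linarith
  refine htend.frequently (Filter.Frequently.of_forall fun k => ?_)
  exact hreal _ (by positivity)

theorem AnalyticAt.pder {m : ℕ} {f : (Fin m → ℂ) → ℂ} {x : Fin m → ℂ} (hf : AnalyticAt ℂ f x)
    (j : Fin m) : AnalyticAt ℂ (pder j f) x :=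
  ((ContinuousLinearMap.apply ℂ ℂ (Pi.single j (1 : ℂ) : Fin m → ℂ)).analyticAt _).comp hf.fderiv

theorem Filter.EventuallyEq.pder {m : ℕ} {f g : (Fin m → ℂ) → ℂ} {x : Fin m → ℂ}
    (h : f =ᶠ[nhds x] g) (j : Fin m) : pder j f =ᶠ[nhds x] _root_.pder j g := by
  filter_upwards [h.fderiv (𝕜 := ℂ)] with y hy
  simp only [_root_.pder, hy]

theorem pder_comm {m : ℕ} {f : (Fin m → ℂ) → ℂ} {x : Fin m → ℂ} (hf : AnalyticAt ℂ f x)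
    (i j : Fin m) : pder i (pder j f) =ᶠ[nhds x] pder j (pder i f) := by
  filter_upwards [hf.eventually_analyticAt] with y hy
  have hsymm : IsSymmSndFDerivAt ℂ f y := hy.contDiffAt.isSymmSndFDerivAt_of_omega
  have h2 : ∀ a b : Fin m, pder a (pder b f) y =
      fderiv ℂ (fderiv ℂ f) y (Pi.single a 1) (Pi.single b 1) := by
    intro a b
    have hd : DifferentiableAt ℂ (fderiv ℂ f) y := hy.fderiv.differentiableAt
    have : HasFDerivAt (fun z => fderiv ℂ f z (Pi.single b (1 : ℂ)))
        ((fderiv ℂ (fderiv ℂ f) y).flip (Pi.single b 1)) y := by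
      simpa using! hd.hasFDerivAt.clm_apply (hasFDerivAt_const (Pi.single b (1 : ℂ)) y)
    change fderiv ℂ (fun z => fderiv ℂ f z (Pi.single b (1 : ℂ))) y (Pi.single a 1) = _
    rw [this.fderiv]
    rfl
  rw [h2, h2]
  exact hsymm _ _

/-- Iterated mixed partial derivative taken along a list of coordinates. -/
def mderList {m : ℕ} (L : List (Fin m)) (β : Fin m → ℕ) (h : (Fin m → ℂ) → ℂ) :
    (Fin m → ℂ) → ℂ :=
  L.foldr (fun j acc => (pder j)^[β j] acc) h

theorem mder_eq_mderList {m : ℕ} (β : Fin m → ℕ) (h : (Fin m → ℂ) → ℂ) :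
    mder β h = mderList (List.finRange m) β h := rfl

theorem AnalyticAt.pder_iterate {m : ℕ} {f : (Fin m → ℂ) → ℂ} {x : Fin m → ℂ}
    (hf : AnalyticAt ℂ f x) (j : Fin m) (k : ℕ) : AnalyticAt ℂ ((_root_.pder j)^[k] f) x := by
  induction k with
  | zero => exact hf
  | succ k ih =>
    rw [Function.iterate_succ_apply']
    exact ih.pder j

theorem AnalyticAt.mderList {m : ℕ} {f : (Fin m → ℂ) → ℂ} {x : Fin m → ℂ}
    (hf : AnalyticAt ℂ f x) (L : List (Fin m)) (β : Fin m → ℕ) :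
    AnalyticAt ℂ (mderList L β f) x := by
  induction L with
  | nil => exact hf
  | cons i L ih => exact ih.pder_iterate i _

theorem Filter.EventuallyEq.pder_iterate {m : ℕ} {f g : (Fin m → ℂ) → ℂ} {x : Fin m → ℂ}
    (h : f =ᶠ[nhds x] g) (j : Fin m) (k : ℕ) :
    (_root_.pder j)^[k] f =ᶠ[nhds x] (_root_.pder j)^[k] g := by
  induction k with
  | zero => exact h
  | succ k ih =>
    rw [Function.iterate_succ_apply', Function.iterate_succ_apply']
    exact ih.pder j

theorem Filter.EventuallyEq.mderList {m : ℕ} {f g : (Fin m → ℂ) → ℂ} {x : Fin m → ℂ}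
    (h : f =ᶠ[nhds x] g) (L : List (Fin m)) (β : Fin m → ℕ) :
    mderList L β f =ᶠ[nhds x] _root_.mderList L β g := by
  induction L with
  | nil => exact h
  | cons i L ih => exact ih.pder_iterate i _

theorem mderList_congr_exponent {m : ℕ} {L : List (Fin m)} {β β' : Fin m → ℕ}
    (h : ∀ i ∈ L, β i = β' i) (f : (Fin m → ℂ) → ℂ) : mderList L β f = mderList L β' f := by
  induction L with
  | nil => rfl
  | cons i L ih =>
    have h1 := ih fun k hk => h k (List.mem_cons_of_mem _ hk)
    change (pder i)^[β i] (mderList L β f) = (pder i)^[β' i] (mderList L β' f)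
    rw [h1, h i List.mem_cons_self]

/-- An operation on germs commuting with partial derivatives commutes with mixed ones. -/
theorem mderList_comm_of_pder_comm {m : ℕ} {Q : Type*} {x : Fin m → ℂ}
    (Φ : (Q → (Fin m → ℂ) → ℂ) → (Fin m → ℂ) → ℂ) (L : List (Fin m)) (β : Fin m → ℕ)
    (hΦ : ∀ f, (∀ q, AnalyticAt ℂ (f q) x) → ∀ i ∈ L, β i ≠ 0 →
      pder i (Φ f) =ᶠ[nhds x] Φ fun q => pder i (f q))
    (f : Q → (Fin m → ℂ) → ℂ) (hf : ∀ q, AnalyticAt ℂ (f q) x) :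
    mderList L β (Φ f) =ᶠ[nhds x] Φ fun q => mderList L β (f q) := by
  induction L with
  | nil => exact Filter.EventuallyEq.rfl
  | cons i L ih =>
    have ih' := ih fun g hg k hk => hΦ g hg k (List.mem_cons_of_mem _ hk)
    have hstep : ∀ k ≤ β i, (pder i)^[k] (mderList L β (Φ f)) =ᶠ[nhds x]
        Φ fun q => (pder i)^[k] (mderList L β (f q)) := by
      intro k
      induction k with
      | zero => exact fun _ => ih'
      | succ k ihk =>
        intro hk
        simp only [Function.iterate_succ_apply']
        exact ((ihk (by omega)).pder i).trans
          (hΦ _ (fun q => ((hf q).mderList L β).pder_iterate i k) i List.mem_cons_self (by omega))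
    exact hstep _ le_rfl

theorem pder_mderList_comm {m : ℕ} {x : Fin m → ℂ} {f : (Fin m → ℂ) → ℂ} (hf : AnalyticAt ℂ f x)
    (L : List (Fin m)) (β : Fin m → ℕ) (j : Fin m) :
    mderList L β (pder j f) =ᶠ[nhds x] pder j (mderList L β f) :=
  mderList_comm_of_pder_comm (Q := Unit) (fun f => pder j (f ())) L β
    (fun _ hf i _ _ => pder_comm (hf ()) i j) (fun _ => f) fun _ => hf

theorem mderList_sum {m : ℕ} {Q : Type*} {x : Fin m → ℂ} (S : Finset Q) (c : Q → ℂ)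
    (f : Q → (Fin m → ℂ) → ℂ) (hf : ∀ q, AnalyticAt ℂ (f q) x) (L : List (Fin m))
    (β : Fin m → ℕ) :
    mderList L β (fun σ => ∑ q ∈ S, c q * f q σ) =ᶠ[nhds x]
      fun σ => ∑ q ∈ S, c q * mderList L β (f q) σ := by
  refine mderList_comm_of_pder_comm (fun f σ => ∑ q ∈ S, c q * f q σ) L β ?_ f hf
  intro f hf i _ _
  have : ∀ᶠ y in nhds x, ∀ q ∈ S, AnalyticAt ℂ (f q) y :=
    (Finset.eventually_all S).2 fun q _ => (hf q).eventually_analyticAt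
  filter_upwards [this] with y hy
  simp only [pder]
  rw [fderiv_fun_sum fun q hq => ((hy q hq).differentiableAt.const_mul (c q)),
    _root_.sum_apply]
  refine Finset.sum_congr rfl fun q hq => ?_
  rw [fderiv_const_mul (hy q hq).differentiableAt]
  rfl

theorem mderList_comp_clm {m : ℕ} (P : (Fin m → ℂ) →L[ℂ] (Fin m → ℂ)) {x : Fin m → ℂ}
    (hx : P x = x) (f : (Fin m → ℂ) → ℂ) (hf : AnalyticAt ℂ f x) (L : List (Fin m))
    (β : Fin m → ℕ) (hP : ∀ i, β i ≠ 0 → P (Pi.single i 1) = Pi.single i 1) :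
    mderList L β (fun σ => f (P σ)) =ᶠ[nhds x] fun σ => mderList L β f (P σ) := by
  refine mderList_comm_of_pder_comm (Q := Unit) (fun f σ => f () (P σ)) L β ?_ (fun _ => f)
    fun _ => hf
  intro f hf i _ hi
  have h1 : ∀ᶠ y in nhds (P x), AnalyticAt ℂ (f ()) y := by
    rw [hx]
    exact (hf ()).eventually_analyticAt
  filter_upwards [P.continuous.continuousAt.eventually h1] with y hy
  simp only [pder]
  have := hy.differentiableAt.hasFDerivAt.comp y P.hasFDerivAt
  rw [show (fun σ => f () (P σ)) = f () ∘ P from rfl, this.fderiv,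
    ContinuousLinearMap.comp_apply, hP i hi]

/-- One derivative in a coordinate of a duplicate-free list can be performed first. -/
theorem mderList_eq_mderList_pder {m : ℕ} {x : Fin m → ℂ} {f : (Fin m → ℂ) → ℂ}
    (hf : AnalyticAt ℂ f x) {L : List (Fin m)} (hL : L.Nodup) {β : Fin m → ℕ} {j : Fin m}
    (hj : j ∈ L) (hβ : β j ≠ 0) :
    mderList L β f =ᶠ[nhds x] mderList L (Function.update β j (β j - 1)) (pder j f) := by
  induction L with
  | nil => simp at hj
  | cons i L ih =>
    rw [List.nodup_cons] at hL
    change (pder i)^[β i] (mderList L β f) =ᶠ[nhds x]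
      (pder i)^[Function.update β j (β j - 1) i]
        (mderList L (Function.update β j (β j - 1)) (pder j f))
    by_cases hij : i = j
    · subst hij
      obtain ⟨k, hk⟩ := Nat.exists_eq_succ_of_ne_zero hβ
      rw [Function.update_self, mderList_congr_exponent (β := Function.update β i (β i - 1))
        (β' := β), hk, Nat.succ_sub_one, Function.iterate_succ_apply]
      · exact (pder_mderList_comm hf L β i).symm.pder_iterate i k
      · intro l hl
        rw [Function.update_of_ne]
        rintro rfl
        exact hL.1 hl
    · rw [Function.update_of_ne hij]
      refine (ih hL.2 ?_).pder_iterate i _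
      rcases List.mem_cons.1 hj with h | h
      · exact absurd h.symm hij
      · exact h

theorem mder_eventuallyEq_mder_pder {m : ℕ} {x : Fin m → ℂ} {f : (Fin m → ℂ) → ℂ}
    (hf : AnalyticAt ℂ f x) {β : Fin m → ℕ} {j : Fin m} (hβ : β j ≠ 0) :
    mder β f =ᶠ[nhds x] mder (Function.update β j (β j - 1)) (pder j f) :=
  mderList_eq_mderList_pder hf (List.nodup_finRange m) (List.mem_finRange j) hβ

theorem mder_update_eventuallyEq_mder_pder_iterate {m : ℕ} {x : Fin m → ℂ}
    {f : (Fin m → ℂ) → ℂ} (hf : AnalyticAt ℂ f x) (β : Fin m → ℕ) (j : Fin m) (k : ℕ) :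
    mder (Function.update β j k) f =ᶠ[nhds x] mder (Function.update β j 0) ((pder j)^[k] f) := by
  induction k generalizing f with
  | zero => exact Filter.EventuallyEq.rfl
  | succ k ih =>
    have h := mder_eventuallyEq_mder_pder hf (β := Function.update β j (k + 1)) (j := j)
      (by simp)
    simp only [Function.update_self, Function.update_idem, Nat.add_sub_cancel] at h
    exact h.trans (ih (hf.pder j))

/-- Averaging one coordinate of a product measure. -/
theorem measurePreserving_update {n : ℕ} (μ μ' : Fin n → Measure ℝ) [∀ i, SigmaFinite (μ i)]
    [∀ i, SigmaFinite (μ' i)] (j : Fin n) [IsProbabilityMeasure (μ' j)]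
    (h : ∀ i, i ≠ j → μ' i = μ i) :
    MeasurePreserving (fun p : (Fin n → ℝ) × ℝ => Function.update p.1 j p.2)
      ((Measure.pi μ').prod (μ j)) (Measure.pi μ) := by
  have hm : Measurable fun p : (Fin n → ℝ) × ℝ => Function.update p.1 j p.2 := by
    refine measurable_pi_lambda _ fun i => ?_
    by_cases hi : i = j
    · subst hi
      simpa using measurable_snd
    · simp only [Function.update_of_ne hi]
      exact (measurable_pi_apply i).comp measurable_fst
  refine ⟨hm, (Measure.pi_eq fun s hs => ?_).symm⟩
  rw [Measure.map_apply hm (MeasurableSet.univ_pi hs)]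
  have hpre : (fun p : (Fin n → ℝ) × ℝ => Function.update p.1 j p.2) ⁻¹' Set.univ.pi s =
      (Set.univ.pi (Function.update s j Set.univ)) ×ˢ s j := by
    ext ⟨x, t⟩
    simp only [Set.mem_preimage, Set.mem_pi, Set.mem_univ, true_imp_iff, Set.mem_prod]
    constructor
    · intro hx
      refine ⟨fun i => ?_, by simpa using hx j⟩
      by_cases hi : i = j
      · subst hi
        simp
      · simpa [hi] using hx i
    · rintro ⟨hx, ht⟩ i
      by_cases hi : i = j
      · subst hi
        simpa using ht
      · simpa [hi] using hx i
  rw [hpre, Measure.prod_prod, Measure.pi_pi, ← Finset.mul_prod_erase _ _ (Finset.mem_univ j),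
    ← Finset.mul_prod_erase _ (fun i => μ i (s i)) (Finset.mem_univ j), Function.update_self,
    measure_univ, one_mul, mul_comm]
  congr 1
  refine Finset.prod_congr rfl fun i hi => ?_
  have hij := Finset.ne_of_mem_erase hi
  rw [Function.update_of_ne hij, h i hij]

theorem integral_pi_eq_integral_integral_update {n : ℕ} (μ μ' : Fin n → Measure ℝ)
    [∀ i, SigmaFinite (μ i)] [∀ i, SigmaFinite (μ' i)] (j : Fin n) [IsProbabilityMeasure (μ' j)]
    (h : ∀ i, i ≠ j → μ' i = μ i) {f : (Fin n → ℝ) → ℂ} (hf : Integrable f (Measure.pi μ)) :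
    ∫ x, f x ∂(Measure.pi μ) =
      ∫ x, ∫ t, f (Function.update x j t) ∂(μ j) ∂(Measure.pi μ') := by
  have hp := measurePreserving_update μ μ' j h
  have hf' : AEStronglyMeasurable f
      (((Measure.pi μ').prod (μ j)).map fun p => Function.update p.1 j p.2) := by
    rw [hp.map_eq]
    exact hf.1
  have hi := (hp.integrable_comp hf.1).2 hf
  rw [← hp.map_eq, integral_map hp.measurable.aemeasurable hf']
  exact integral_prod _ hi

theorem integrable_integral_update {n : ℕ} (μ μ' : Fin n → Measure ℝ)
    [∀ i, SigmaFinite (μ i)] [∀ i, SigmaFinite (μ' i)] (j : Fin n) [IsProbabilityMeasure (μ' j)]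
    (h : ∀ i, i ≠ j → μ' i = μ i) {f : (Fin n → ℝ) → ℂ} (hf : Integrable f (Measure.pi μ)) :
    Integrable (fun x => ∫ t, f (Function.update x j t) ∂(μ j)) (Measure.pi μ') :=
  (((measurePreserving_update μ μ' j h).integrable_comp hf.1).2 hf).integral_prod_left

/-- Lebesgue measure on the open unit interval. -/
def unitMeasure : Measure ℝ := volume.restrict (Set.Ioo (0 : ℝ) 1)

instance : IsProbabilityMeasure unitMeasure := ⟨by simp [unitMeasure]⟩

/-- Lebesgue measure on the open unit cube. -/
def cubeMeasure (n : ℕ) : Measure (Fin n → ℝ) := Measure.pi fun _ => unitMeasure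

instance (n : ℕ) : IsProbabilityMeasure (cubeMeasure n) := by
  unfold cubeMeasure
  infer_instance

theorem ae_cubeMeasure (n : ℕ) : ∀ᵐ σ ∂cubeMeasure n, ∀ j, σ j ∈ Set.Ioo (0 : ℝ) 1 := by
  rw [ae_all_iff]
  intro j
  have : ∀ᵐ t ∂unitMeasure, t ∈ Set.Ioo (0 : ℝ) 1 := ae_restrict_mem measurableSet_Ioo
  exact (Measure.quasiMeasurePreserving_eval (fun _ : Fin n => unitMeasure) j).ae this

/-- The closed unit cube of real points in complex affine space. -/
def realCube (n : ℕ) : Set (Fin n → ℂ) :=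
  Set.univ.pi fun _ => Complex.ofReal '' Set.Icc (0 : ℝ) 1

theorem isCompact_realCube (n : ℕ) : IsCompact (realCube n) :=
  isCompact_univ_pi fun _ => isCompact_Icc.image Complex.continuous_ofReal

theorem convex_realCube (n : ℕ) : Convex ℝ (realCube n) :=
  convex_pi fun _ _ => (convex_Icc (0 : ℝ) 1).linear_image Complex.ofRealCLM.toLinearMap

theorem ofReal_mem_realCube {n : ℕ} {σ : Fin n → ℝ} (hσ : ∀ j, σ j ∈ Set.Icc (0 : ℝ) 1) :
    (fun j => (σ j : ℂ)) ∈ realCube n := fun j _ => ⟨σ j, hσ j, rfl⟩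

theorem update_mem_realCube {n : ℕ} {x : Fin n → ℂ} (hx : x ∈ realCube n) (j : Fin n) {t : ℝ}
    (ht : t ∈ Set.Icc (0 : ℝ) 1) : Function.update x j (t : ℂ) ∈ realCube n := by
  intro i _
  by_cases hi : i = j
  · subst hi
    simpa using ht
  · rw [Function.update_of_ne hi]
    exact hx i trivial

theorem zero_mem_realCube (n : ℕ) : (0 : Fin n → ℂ) ∈ realCube n :=
  fun _ _ => ⟨0, by simp, by simp⟩

/-- The integrand `∏ σ_j^{z_j-1} G(σ)` on the unit cube. -/
def cubeIntegrand {n : ℕ} (z : Fin n → ℂ) (G : (Fin n → ℂ) → ℂ) (σ : Fin n → ℝ) : ℂ :=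
  (∏ j, (σ j : ℂ) ^ (z j - 1)) * G fun j => (σ j : ℂ)

/-- The multivariate Mellin transform on the unit cube. -/
def cubeMellin {n : ℕ} (z : Fin n → ℂ) (G : (Fin n → ℂ) → ℂ) : ℂ :=
  ∫ σ, cubeIntegrand z G σ ∂cubeMeasure n

theorem aestronglyMeasurable_cubeIntegrand {n : ℕ} (z : Fin n → ℂ) {G : (Fin n → ℂ) → ℂ}
    (hG : ContinuousOn G (realCube n)) :
    AEStronglyMeasurable (cubeIntegrand z G) (cubeMeasure n) := by
  refine AEStronglyMeasurable.mul (Measurable.aestronglyMeasurable (by fun_prop)) ?_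
  have hμ : cubeMeasure n =
      (cubeMeasure n).restrict (Set.univ.pi fun _ => Set.Icc (0 : ℝ) 1) := by
    refine (Measure.restrict_eq_self_of_ae_mem ?_).symm
    filter_upwards [ae_cubeMeasure n] with σ hσ j _
    exact Set.Ioo_subset_Icc_self (hσ j)
  rw [hμ]
  refine ContinuousOn.aestronglyMeasurable ?_ (MeasurableSet.univ_pi fun _ => measurableSet_Icc)
  refine hG.comp (Continuous.continuousOn (by fun_prop)) fun σ hσ => ?_
  exact ofReal_mem_realCube fun j => hσ j trivial

theorem integrable_rpow_sub_one_unitMeasure {a : ℝ} (ha : 0 < a) :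
    Integrable (fun t : ℝ => t ^ (a - 1)) unitMeasure := by
  have := (intervalIntegral.integrableOn_Ioo_rpow_iff (s := a - 1) (t := 1) one_pos).2
    (by linarith)
  exact this

theorem integrable_prod_rpow_cubeMeasure {n : ℕ} {a : Fin n → ℝ} (ha : ∀ j, 0 < a j) :
    Integrable (fun σ : Fin n → ℝ => ∏ j, σ j ^ (a j - 1)) (cubeMeasure n) :=
  Integrable.fintype_prod fun j => integrable_rpow_sub_one_unitMeasure (ha j)

theorem norm_cubeIntegrand {n : ℕ} (z : Fin n → ℂ) (G : (Fin n → ℂ) → ℂ) {σ : Fin n → ℝ}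
    (hσ : ∀ j, 0 < σ j) :
    ‖cubeIntegrand z G σ‖ = (∏ j, σ j ^ ((z j).re - 1)) * ‖G fun j => (σ j : ℂ)‖ := by
  rw [cubeIntegrand, norm_mul, norm_prod]
  congr 1
  refine Finset.prod_congr rfl fun j _ => ?_
  rw [Complex.norm_cpow_eq_rpow_re_of_pos (hσ j)]
  simp

theorem integrable_cubeIntegrand {n : ℕ} {z : Fin n → ℂ} (hz : ∀ j, 0 < (z j).re)
    {G : (Fin n → ℂ) → ℂ} (hG : ContinuousOn G (realCube n)) :
    Integrable (cubeIntegrand z G) (cubeMeasure n) := by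
  obtain ⟨C, hC⟩ := (isCompact_realCube n).exists_bound_of_continuousOn hG
  refine Integrable.mono' ((integrable_prod_rpow_cubeMeasure hz).mul_const C)
    (aestronglyMeasurable_cubeIntegrand z hG) ?_
  filter_upwards [ae_cubeMeasure n] with σ hσ
  rw [norm_cubeIntegrand z G fun j => (hσ j).1]
  exact mul_le_mul_of_nonneg_left
    (hC _ (ofReal_mem_realCube fun j => Set.Ioo_subset_Icc_self (hσ j)))
    (Finset.prod_nonneg fun j _ => Real.rpow_nonneg (hσ j).1.le _)

theorem mul_integral_cpow_sub_one_mul {z : ℂ} (hz : 0 < z.re) {g g' : ℝ → ℂ}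
    (hg : ∀ t ∈ Set.Icc (0 : ℝ) 1, HasDerivAt g (g' t) t)
    (hg' : ContinuousOn g' (Set.Icc (0 : ℝ) 1)) :
    z * ∫ t, (t : ℂ) ^ (z - 1) * g t ∂unitMeasure =
      g 1 - ∫ t, (t : ℂ) ^ z * g' t ∂unitMeasure := by
  have hz0 : z ≠ 0 := by
    rintro rfl
    simp at hz
  have hgc : ContinuousOn g (Set.Icc (0 : ℝ) 1) := fun t ht =>
    (hg t ht).continuousAt.continuousWithinAt
  have hconv : ∀ f : ℝ → ℂ, ∫ t, f t ∂unitMeasure = ∫ t in (0 : ℝ)..1, f t := fun f => by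
    rw [intervalIntegral.integral_of_le zero_le_one, integral_Ioc_eq_integral_Ioo]
    rfl
  have hI1 : IntervalIntegrable (fun t : ℝ => z * (t : ℂ) ^ (z - 1) * g t) volume 0 1 := by
    refine IntervalIntegrable.mul_continuousOn ?_ (by rwa [Set.uIcc_of_le zero_le_one])
    exact (intervalIntegral.intervalIntegrable_cpow' (by simpa using hz)).const_mul z
  have hcpow : ContinuousOn (fun t : ℝ => (t : ℂ) ^ z) (Set.Icc (0 : ℝ) 1) :=
    (Complex.continuous_ofReal_cpow_const hz).continuousOn
  have hI2 : IntervalIntegrable (fun t : ℝ => (t : ℂ) ^ z * g' t) volume 0 1 := by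
    refine ContinuousOn.intervalIntegrable ?_
    rw [Set.uIcc_of_le zero_le_one]
    exact hcpow.mul hg'
  have hftc := intervalIntegral.integral_eq_sub_of_hasDerivAt_of_le (a := (0 : ℝ)) (b := 1)
    (f := fun t : ℝ => (t : ℂ) ^ z * g t)
    (f' := fun t : ℝ => z * (t : ℂ) ^ (z - 1) * g t + (t : ℂ) ^ z * g' t) zero_le_one
    (hcpow.mul hgc) ?_ (hI1.add hI2)
  · rw [intervalIntegral.integral_add hI1 hI2] at hftc
    simp only [Complex.ofReal_zero, Complex.ofReal_one, Complex.one_cpow, one_mul,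
      Complex.zero_cpow hz0, zero_mul, sub_zero] at hftc
    rw [hconv, hconv, ← hftc]
    simp only [mul_assoc, intervalIntegral.integral_const_mul]
    ring
  · intro t ht
    refine HasDerivAt.mul ?_ (hg t (Set.Ioo_subset_Icc_self ht))
    have h1 : HasDerivAt (fun w : ℂ => w ^ z) (z * (t : ℂ) ^ (z - 1)) (t : ℂ) := by
      simpa using (hasDerivAt_id (t : ℂ)).cpow_const (c := z) (Or.inl (by simpa using ht.1))
    exact h1.comp_ofReal

theorem cubeIntegrand_update {n : ℕ} (z : Fin n → ℂ) (G : (Fin n → ℂ) → ℂ) (σ : Fin n → ℝ)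
    (j : Fin n) (t : ℝ) :
    cubeIntegrand z G (Function.update σ j t) =
      (∏ i ∈ Finset.univ.erase j, (σ i : ℂ) ^ (z i - 1)) *
        ((t : ℂ) ^ (z j - 1) * G (Function.update (fun i => (σ i : ℂ)) j (t : ℂ))) := by
  have h1 : (fun i => ((Function.update σ j t i : ℝ) : ℂ)) =
      Function.update (fun i => (σ i : ℂ)) j (t : ℂ) := by
    ext i
    by_cases hi : i = j
    · subst hi
      simp
    · simp [hi]
  rw [cubeIntegrand, h1, ← Finset.mul_prod_erase _ _ (Finset.mem_univ j), Function.update_self]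
  have h2 : ∏ i ∈ Finset.univ.erase j, ((Function.update σ j t i : ℝ) : ℂ) ^ (z i - 1) =
      ∏ i ∈ Finset.univ.erase j, (σ i : ℂ) ^ (z i - 1) := by
    refine Finset.prod_congr rfl fun i hi => ?_
    rw [Function.update_of_ne (Finset.ne_of_mem_erase hi)]
  rw [h2]
  ring

theorem AnalyticOnNhd.pder {m : ℕ} {G : (Fin m → ℂ) → ℂ} {K : Set (Fin m → ℂ)}
    (hG : AnalyticOnNhd ℂ G K) (j : Fin m) : AnalyticOnNhd ℂ (_root_.pder j G) K :=
  fun x hx => (hG x hx).pder j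

theorem cubeMellin_eq_integral_integral {n : ℕ} {z : Fin n → ℂ} (hz : ∀ j, 0 < (z j).re)
    {G : (Fin n → ℂ) → ℂ} (hG : ContinuousOn G (realCube n)) (j : Fin n) :
    Integrable (fun σ : Fin n → ℝ => (∏ i ∈ Finset.univ.erase j, (σ i : ℂ) ^ (z i - 1)) *
      ∫ t, (t : ℂ) ^ (z j - 1) * G (Function.update (fun i => (σ i : ℂ)) j (t : ℂ)) ∂unitMeasure)
      (cubeMeasure n) ∧
    cubeMellin z G = ∫ σ, (∏ i ∈ Finset.univ.erase j, (σ i : ℂ) ^ (z i - 1)) *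
      ∫ t, (t : ℂ) ^ (z j - 1) * G (Function.update (fun i => (σ i : ℂ)) j (t : ℂ)) ∂unitMeasure
        ∂cubeMeasure n := by
  have hi := integrable_cubeIntegrand hz hG
  have h1 := integrable_integral_update (fun _ => unitMeasure) (fun _ => unitMeasure) j
    (fun _ _ => rfl) hi
  have h2 := integral_pi_eq_integral_integral_update (fun _ => unitMeasure)
    (fun _ => unitMeasure) j (fun _ _ => rfl) hi
  simp only [cubeIntegrand_update, integral_const_mul] at h1 h2
  exact ⟨h1, h2⟩

/-- Integration by parts in one coordinate. -/
theorem mul_cubeMellin {n : ℕ} {z : Fin n → ℂ} (hz : ∀ j, 0 < (z j).re)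
    {G : (Fin n → ℂ) → ℂ} (hG : AnalyticOnNhd ℂ G (realCube n)) (j : Fin n) :
    z j * cubeMellin z G =
      cubeMellin (Function.update z j 1) (fun x => G (Function.update x j 1)) -
        cubeMellin (Function.update z j (z j + 1)) (pder j G) := by
  have hupd : ∀ w : ℂ, 0 < w.re → ∀ i, 0 < (Function.update z j w i).re := by
    intro w hw i
    by_cases hi : i = j
    · subst hi
      simpa using hw
    · simpa [hi] using hz i
  have hG1 : ContinuousOn (fun x => G (Function.update x j 1)) (realCube n) := by
    refine hG.continuousOn.comp ?_ fun x hx => by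
      simpa using update_mem_realCube hx j (t := 1) (by simp)
    exact (continuous_id.update j continuous_const).continuousOn
  have hc : ∀ (w : ℂ) (σ : Fin n → ℝ),
      ∏ i ∈ Finset.univ.erase j, (σ i : ℂ) ^ (Function.update z j w i - 1) =
        ∏ i ∈ Finset.univ.erase j, (σ i : ℂ) ^ (z i - 1) := by
    intro w σ
    refine Finset.prod_congr rfl fun i hi => ?_
    rw [Function.update_of_ne (Finset.ne_of_mem_erase hi)]
  obtain ⟨-, e1⟩ := cubeMellin_eq_integral_integral hz hG.continuousOn j
  obtain ⟨i2, e2⟩ := cubeMellin_eq_integral_integral (hupd 1 (by simp)) hG1 j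
  obtain ⟨i3, e3⟩ := cubeMellin_eq_integral_integral
    (hupd (z j + 1) (by have := hz j; simp; linarith)) (hG.pder j).continuousOn j
  simp only [hc, Function.update_self, sub_self, Complex.cpow_zero, one_mul,
    Function.update_idem, add_sub_cancel_right] at i2 e2 i3 e3
  rw [e1, e2, e3, ← integral_sub i2 i3, ← integral_const_mul]
  refine integral_congr_ae ?_
  filter_upwards [ae_cubeMeasure n] with σ hσ
  have hmem : (fun i => (σ i : ℂ)) ∈ realCube n :=
    ofReal_mem_realCube fun i => Set.Ioo_subset_Icc_self (hσ i)
  have key := mul_integral_cpow_sub_one_mul (hz j)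
    (g := fun t : ℝ => G (Function.update (fun i => (σ i : ℂ)) j (t : ℂ)))
    (g' := fun t : ℝ => pder j G (Function.update (fun i => (σ i : ℂ)) j (t : ℂ))) ?_ ?_
  · simp only [Complex.ofReal_one] at key
    rw [mul_left_comm, key, ← mul_sub]
    simp
  · intro t ht
    have h1 := (hG _ (update_mem_realCube hmem j ht)).differentiableAt.hasFDerivAt
    have h2 := h1.comp_hasDerivAt (t : ℂ) (hasDerivAt_update (fun i => (σ i : ℂ)) j (t : ℂ))
    exact h2.comp_ofReal
  · refine (hG.pder j).continuousOn.comp ?_ fun t ht => update_mem_realCube hmem j ht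
    exact (continuous_const.update j Complex.continuous_ofReal).continuousOn

theorem integral_rpow_sub_one_unitMeasure {a : ℝ} (ha : 0 < a) :
    ∫ t, t ^ (a - 1) ∂unitMeasure = a⁻¹ := by
  rw [unitMeasure, ← integral_Ioc_eq_integral_Ioo,
    ← intervalIntegral.integral_of_le zero_le_one, integral_rpow (Or.inl (by linarith))]
  simp [Real.zero_rpow ha.ne']

theorem integral_prod_rpow_cubeMeasure {n : ℕ} {a : Fin n → ℝ} (ha : ∀ j, 0 < a j) :
    ∫ σ, ∏ j, σ j ^ (a j - 1) ∂cubeMeasure n = ∏ j, (a j)⁻¹ := by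
  rw [cubeMeasure, integral_fintype_prod_eq_prod (fun j (t : ℝ) => t ^ (a j - 1))]
  exact Finset.prod_congr rfl fun j _ => integral_rpow_sub_one_unitMeasure (ha j)

theorem integral_prod_rpow_mul_coord_cubeMeasure {n : ℕ} {a : Fin n → ℝ} (ha : ∀ j, 0 < a j)
    (j : Fin n) :
    Integrable (fun σ : Fin n → ℝ => (∏ i, σ i ^ (a i - 1)) * σ j) (cubeMeasure n) ∧
    ∫ σ, (∏ i, σ i ^ (a i - 1)) * σ j ∂cubeMeasure n = (a j / (a j + 1)) * ∏ i, (a i)⁻¹ := by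
  have hb : ∀ i, 0 < Function.update a j (a j + 1) i := by
    intro i
    by_cases hi : i = j
    · subst hi
      simpa using (ha i).trans (lt_add_one _)
    · simpa [hi] using ha i
  have he : (fun σ : Fin n → ℝ => ∏ i, σ i ^ (Function.update a j (a j + 1) i - 1))
      =ᵐ[cubeMeasure n] fun σ => (∏ i, σ i ^ (a i - 1)) * σ j := by
    filter_upwards [ae_cubeMeasure n] with σ hσ
    rw [← Finset.mul_prod_erase _ _ (Finset.mem_univ j),
      ← Finset.mul_prod_erase _ (fun i => σ i ^ (a i - 1)) (Finset.mem_univ j)]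
    have h1 : ∏ i ∈ Finset.univ.erase j, σ i ^ (Function.update a j (a j + 1) i - 1) =
        ∏ i ∈ Finset.univ.erase j, σ i ^ (a i - 1) :=
      Finset.prod_congr rfl fun i hi => by
        rw [Function.update_of_ne (Finset.ne_of_mem_erase hi)]
    have h2 : σ j ^ (Function.update a j (a j + 1) j - 1) = σ j ^ (a j - 1) * σ j := by
      rw [Function.update_self, add_sub_right_comm, Real.rpow_add (hσ j).1, Real.rpow_one]
    rw [h1, h2]
    ring
  refine ⟨(integrable_prod_rpow_cubeMeasure hb).congr he, ?_⟩
  rw [← integral_congr_ae he, integral_prod_rpow_cubeMeasure hb,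
    ← Finset.mul_prod_erase _ _ (Finset.mem_univ j),
    ← Finset.mul_prod_erase _ (fun i => (a i)⁻¹) (Finset.mem_univ j)]
  have h1 : ∏ i ∈ Finset.univ.erase j, (Function.update a j (a j + 1) i)⁻¹ =
      ∏ i ∈ Finset.univ.erase j, (a i)⁻¹ :=
    Finset.prod_congr rfl fun i hi => by
      rw [Function.update_of_ne (Finset.ne_of_mem_erase hi)]
  rw [h1, Function.update_self]
  have := (ha j).ne'
  field_simp

theorem cubeMellin_const {n : ℕ} {a : Fin n → ℝ} (ha : ∀ j, 0 < a j) (c : ℂ) :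
    cubeMellin (fun j => (a j : ℂ)) (fun _ => c) = ((∏ j, (a j)⁻¹ : ℝ) : ℂ) * c := by
  rw [← integral_prod_rpow_cubeMeasure ha, ← integral_complex_ofReal, ← integral_mul_const]
  refine integral_congr_ae ?_
  filter_upwards [ae_cubeMeasure n] with σ hσ
  rw [cubeIntegrand]
  congr 1
  push_cast
  refine Finset.prod_congr rfl fun j _ => ?_
  rw [Complex.ofReal_cpow (hσ j).1.le]
  push_cast
  rfl

theorem exists_norm_sub_le_of_analyticOnNhd {n : ℕ} {G : ℂ → (Fin n → ℂ) → ℂ}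
    (hG : AnalyticOnNhd ℂ (fun p : ℂ × (Fin n → ℂ) => G p.1 p.2) (Set.univ ×ˢ realCube n)) :
    ∃ C : ℝ, 0 ≤ C ∧ ∀ ε ∈ Set.Icc (0 : ℝ) 1, ∀ σ : Fin n → ℝ, (∀ j, σ j ∈ Set.Icc (0 : ℝ) 1) →
      ‖G ε (fun j => (σ j : ℂ)) - G 0 0‖ ≤ C * (ε + ∑ j, σ j) := by
  set K : Set (ℂ × (Fin n → ℂ)) := (Complex.ofReal '' Set.Icc (0 : ℝ) 1) ×ˢ realCube n with hK
  have hKc : IsCompact K := (isCompact_Icc.image Complex.continuous_ofReal).prod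
    (isCompact_realCube n)
  have hKx : Convex ℝ K :=
    ((convex_Icc (0 : ℝ) 1).linear_image Complex.ofRealCLM.toLinearMap).prod (convex_realCube n)
  have hKG := hG.mono (Set.prod_mono_left (Set.subset_univ (Complex.ofReal '' Set.Icc (0 : ℝ) 1)))
  obtain ⟨C, hC⟩ := hKc.exists_bound_of_continuousOn hKG.fderiv.continuousOn
  have h0 : ((0 : ℂ), (0 : Fin n → ℂ)) ∈ K := ⟨⟨0, by simp, by simp⟩, zero_mem_realCube n⟩
  have hC0 : 0 ≤ C := (norm_nonneg _).trans (hC _ h0)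
  refine ⟨C, hC0, fun ε hε σ hσ => ?_⟩
  have h1 : ((ε : ℂ), fun j => (σ j : ℂ)) ∈ K := ⟨⟨ε, hε, rfl⟩, ofReal_mem_realCube hσ⟩
  have h := hKx.norm_image_sub_le_of_norm_hasFDerivWithin_le
    (fun x hx => (hKG x hx).differentiableAt.hasFDerivAt.hasFDerivWithinAt) hC h0 h1
  refine h.trans (mul_le_mul_of_nonneg_left ?_ hC0)
  have hs : 0 ≤ ∑ j, σ j := Finset.sum_nonneg fun j _ => (hσ j).1
  rw [Prod.norm_def]
  simp only [Prod.mk_sub_mk, sub_zero]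
  refine max_le ?_ ?_
  · rw [Complex.norm_real, Real.norm_of_nonneg hε.1]
    linarith
  · refine (pi_norm_le_iff_of_nonneg (add_nonneg hε.1 hs)).2 fun j => ?_
    rw [Complex.norm_real, Real.norm_of_nonneg (hσ j).1]
    have := Finset.single_le_sum (fun j _ => (hσ j).1) (Finset.mem_univ j)
    linarith [hε.1]

theorem analyticOnNhd_slice {n : ℕ} {G : ℂ → (Fin n → ℂ) → ℂ}
    (hG : AnalyticOnNhd ℂ (fun p : ℂ × (Fin n → ℂ) => G p.1 p.2) (Set.univ ×ˢ realCube n))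
    (u : ℂ) : AnalyticOnNhd ℂ (G u) (realCube n) := fun x hx =>
  (hG (u, x) ⟨trivial, hx⟩).comp₂ analyticAt_const analyticAt_id

theorem norm_cubeMellin_sub_const_le {n : ℕ} {a : Fin n → ℝ} (ha : ∀ j, 0 < a j)
    {G : (Fin n → ℂ) → ℂ} (hG : ContinuousOn G (realCube n)) (c : ℂ) {C ε : ℝ}
    (hC : ∀ σ : Fin n → ℝ, (∀ j, σ j ∈ Set.Icc (0 : ℝ) 1) →
      ‖G (fun j => (σ j : ℂ)) - c‖ ≤ C * (ε + ∑ j, σ j)) :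
    ‖cubeMellin (fun j => (a j : ℂ)) G - ((∏ j, (a j)⁻¹ : ℝ) : ℂ) * c‖ ≤
      C * ((∏ j, (a j)⁻¹) * (ε + ∑ j, a j / (a j + 1))) := by
  have ha' : ∀ j, 0 < ((a j : ℂ)).re := by simpa using ha
  rw [← cubeMellin_const ha, cubeMellin, cubeMellin,
    ← integral_sub (integrable_cubeIntegrand ha' hG)
      (integrable_cubeIntegrand ha' continuousOn_const)]
  have hI : ∫ σ : Fin n → ℝ, C * ((∏ j, σ j ^ (a j - 1)) * ε +
      ∑ i, (∏ j, σ j ^ (a j - 1)) * σ i) ∂cubeMeasure n =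
      C * ((∏ j, (a j)⁻¹) * (ε + ∑ j, a j / (a j + 1))) := by
    rw [integral_const_mul, integral_add ((integrable_prod_rpow_cubeMeasure ha).mul_const ε)
      (integrable_finsetSum _ fun i _ => (integral_prod_rpow_mul_coord_cubeMeasure ha i).1),
      integral_mul_const, integral_prod_rpow_cubeMeasure ha, integral_finsetSum _ fun i _ =>
      (integral_prod_rpow_mul_coord_cubeMeasure ha i).1]
    simp only [fun i => (integral_prod_rpow_mul_coord_cubeMeasure ha i).2]
    rw [← Finset.sum_mul]
    ring
  rw [← hI]
  refine norm_integral_le_of_norm_le (Integrable.const_mul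
    (((integrable_prod_rpow_cubeMeasure ha).mul_const ε).add (integrable_finsetSum _ fun i _ =>
      (integral_prod_rpow_mul_coord_cubeMeasure ha i).1)) C) ?_
  filter_upwards [ae_cubeMeasure n] with σ hσ
  have h1 : cubeIntegrand (fun j => (a j : ℂ)) G σ - cubeIntegrand (fun j => (a j : ℂ))
      (fun _ => c) σ = cubeIntegrand (fun j => (a j : ℂ)) (fun x => G x - c) σ := by
    simp only [cubeIntegrand]
    ring
  rw [h1, norm_cubeIntegrand _ _ fun j => (hσ j).1]
  simp only [Complex.ofReal_re]
  rw [← Finset.mul_sum, ← mul_add, mul_left_comm]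
  exact mul_le_mul_of_nonneg_left (hC σ fun j => Set.Ioo_subset_Icc_self (hσ j))
    (Finset.prod_nonneg fun j _ => Real.rpow_nonneg (hσ j).1.le _)

theorem tendsto_pow_mul_cubeMellin {n : ℕ} {p : Fin n → ℕ} (hp : ∀ j, 0 < p j)
    {G : ℂ → (Fin n → ℂ) → ℂ}
    (hG : AnalyticOnNhd ℂ (fun p : ℂ × (Fin n → ℂ) => G p.1 p.2) (Set.univ ×ˢ realCube n)) :
    Filter.Tendsto (fun ε : ℝ => (ε : ℂ) ^ n * cubeMellin (fun j => (p j : ℂ) * ε) (G ε))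
      (nhdsWithin 0 (Set.Ioi 0)) (nhds ((∏ j, (p j : ℂ)⁻¹) * G 0 0)) := by
  obtain ⟨C, hC0, hC⟩ := exists_norm_sub_le_of_analyticOnNhd hG
  have hlim : Filter.Tendsto (fun ε : ℝ => C * ((∏ j, (p j : ℝ)⁻¹) *
      (ε + ∑ j, (p j * ε) / (p j * ε + 1)))) (nhdsWithin 0 (Set.Ioi 0)) (nhds 0) := by
    have hc : ContinuousAt (fun ε : ℝ => C * ((∏ j, (p j : ℝ)⁻¹) *
      (ε + ∑ j, (p j * ε) / (p j * ε + 1)))) 0 := by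
      refine continuousAt_const.mul (continuousAt_const.mul (continuousAt_id.add ?_))
      refine tendsto_finsetSum _ fun j _ => ?_
      exact ContinuousAt.div (by fun_prop) (by fun_prop) (by simp)
    simpa [ContinuousAt] using hc.mono_left nhdsWithin_le_nhds
  rw [tendsto_iff_norm_sub_tendsto_zero]
  refine squeeze_zero' (Filter.Eventually.of_forall fun _ => norm_nonneg _) ?_ hlim
  filter_upwards [Ioo_mem_nhdsGT (zero_lt_one (α := ℝ))] with ε hε
  have ha : ∀ j, 0 < (p j : ℝ) * ε := fun j => mul_pos (Nat.cast_pos.2 (hp j)) hε.1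
  have h := norm_cubeMellin_sub_const_le ha (analyticOnNhd_slice hG ε).continuousOn (G 0 0)
    (hC ε (Set.Ioo_subset_Icc_self hε))
  have hprod : ∏ j, ((p j : ℝ) * ε)⁻¹ = (∏ j, (p j : ℝ)⁻¹) * (ε ^ n)⁻¹ := by
    simp [Finset.prod_mul_distrib, mul_comm]
  have hε0 : (ε : ℝ) ^ n ≠ 0 := pow_ne_zero _ hε.1.ne'
  have hε0' : (ε : ℂ) ^ n ≠ 0 := by exact_mod_cast hε0
  have e1 : (ε : ℂ) ^ n * cubeMellin (fun j => (p j : ℂ) * ε) (G ε) -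
      (∏ j, (p j : ℂ)⁻¹) * G 0 0 = (ε : ℂ) ^ n *
      (cubeMellin (fun j => (((p j : ℝ) * ε : ℝ) : ℂ)) (G ε) -
        ((∏ j, ((p j : ℝ) * ε)⁻¹ : ℝ) : ℂ) * G 0 0) := by
    rw [hprod, mul_sub]
    push_cast
    congr 1
    field_simp
  rw [e1, norm_mul, norm_pow, Complex.norm_real, Real.norm_of_nonneg hε.1.le]
  refine (mul_le_mul_of_nonneg_left h (pow_nonneg hε.1.le n)).trans (le_of_eq ?_)
  rw [hprod]
  field_simp

theorem analyticOnNhd_pder_slice {n : ℕ} {G : ℂ → (Fin n → ℂ) → ℂ}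
    (hG : AnalyticOnNhd ℂ (fun p : ℂ × (Fin n → ℂ) => G p.1 p.2) (Set.univ ×ˢ realCube n))
    (j : Fin n) :
    AnalyticOnNhd ℂ (fun p : ℂ × (Fin n → ℂ) => pder j (G p.1) p.2)
      (Set.univ ×ˢ realCube n) := by
  intro p hp
  have h1 := ((ContinuousLinearMap.apply ℂ ℂ ((0 : ℂ), (Pi.single j (1 : ℂ) : Fin n → ℂ))
    ).analyticAt _).comp (hG p hp).fderiv
  refine h1.congr ?_
  filter_upwards [(hG p hp).eventually_analyticAt] with q hq
  have h2 : HasFDerivAt (fun x : Fin n → ℂ => (q.1, x)) (ContinuousLinearMap.inr ℂ ℂ (Fin n → ℂ))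
      q.2 := hasFDerivAt_prodMk_right q.1 q.2
  have h3 : HasFDerivAt (fun p : ℂ × (Fin n → ℂ) => G p.1 p.2) _ (q.1, q.2) :=
    hq.differentiableAt.hasFDerivAt
  have h4 : HasFDerivAt (G q.1) _ q.2 := h3.comp q.2 h2
  rw [pder, h4.fderiv]
  simp

theorem analyticOnNhd_update_slice {n : ℕ} {G : ℂ → (Fin n → ℂ) → ℂ}
    (hG : AnalyticOnNhd ℂ (fun p : ℂ × (Fin n → ℂ) => G p.1 p.2) (Set.univ ×ˢ realCube n))
    (j : Fin n) :
    AnalyticOnNhd ℂ (fun p : ℂ × (Fin n → ℂ) => G p.1 (Function.update p.2 j 1))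
      (Set.univ ×ˢ realCube n) := by
  intro p hp
  have hu : AnalyticAt ℂ (fun p : ℂ × (Fin n → ℂ) => Function.update p.2 j (1 : ℂ)) p := by
    rw [analyticAt_pi_iff]
    intro i
    by_cases hi : i = j
    · subst hi
      simpa using analyticAt_const
    · simp only [Function.update_of_ne hi]
      exact ((ContinuousLinearMap.proj i : (Fin n → ℂ) →L[ℂ] ℂ).comp
        (ContinuousLinearMap.snd ℂ ℂ (Fin n → ℂ))).analyticAt p
  refine (hG (p.1, Function.update p.2 j 1) ⟨trivial, ?_⟩).comp₂ analyticAt_fst hu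
  simpa using update_mem_realCube hp.2 j (t := 1) (by simp)

theorem re_natCast_mul_sub_intCast (p : ℕ) (m : ℤ) (u : ℂ) :
    ((p : ℂ) * u - m).re = p * u.re - m := by
  simp

theorem differentiableOn_cubeMellin {n : ℕ} {δ : ℝ} {p : Fin n → ℕ} {m : Fin n → ℤ}
    (hδ : ∀ j, p j * δ < 1) (hm : ∀ j, m j ≤ -1) {G : ℂ → (Fin n → ℂ) → ℂ}
    (hG : AnalyticOnNhd ℂ (fun p : ℂ × (Fin n → ℂ) => G p.1 p.2) (Set.univ ×ˢ realCube n)) :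
    DifferentiableOn ℂ (fun u => cubeMellin (fun j => (p j : ℂ) * u - m j) (G u))
      {u : ℂ | -δ < u.re} := by
  refine differentiableOn_integral_of_dominated (isOpen_lt continuous_const continuous_re)
    ?_ ?_ ?_
  · exact fun u _ => aestronglyMeasurable_cubeIntegrand _ (analyticOnNhd_slice hG u).continuousOn
  · filter_upwards [ae_cubeMeasure n] with σ hσ u _
    refine DifferentiableAt.differentiableWithinAt (DifferentiableAt.mul ?_ ?_)
    · refine DifferentiableAt.fun_finsetProd fun j _ => ?_
      exact DifferentiableAt.const_cpow (by fun_prop)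
        (Or.inl (Complex.ofReal_ne_zero.2 (hσ j).1.ne'))
    · have h := (hG (u, fun j => (σ j : ℂ)) ⟨trivial, ofReal_mem_realCube fun j =>
        Set.Ioo_subset_Icc_self (hσ j)⟩).comp₂ analyticAt_id analyticAt_const
      exact h.differentiableAt
  · intro u₀ hu₀
    set ε := (u₀.re + δ) / 2 with hε
    have hε0 : 0 < ε := by
      have : -δ < u₀.re := hu₀
      linarith
    have hK := (isCompact_closedBall u₀ ε).prod (isCompact_realCube n)
    obtain ⟨C, hC⟩ := hK.exists_bound_of_continuousOn
      (hG.mono (Set.prod_mono_left (Set.subset_univ _))).continuousOn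
    have ha : ∀ j, 0 < (p j : ℝ) * (u₀.re - ε) - m j := by
      intro j
      have h1 : (m j : ℝ) ≤ -1 := by exact_mod_cast hm j
      have h2 : (p j : ℝ) * (-δ) ≤ p j * (u₀.re - ε) :=
        mul_le_mul_of_nonneg_left (by linarith) (Nat.cast_nonneg _)
      linarith [hδ j]
    refine ⟨ε, hε0, _, (integrable_prod_rpow_cubeMeasure ha).mul_const C, ?_⟩
    filter_upwards [ae_cubeMeasure n] with σ hσ u hu _
    rw [norm_cubeIntegrand _ _ fun j => (hσ j).1]
    have hu' : u₀.re - ε ≤ u.re := by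
      have h1 : |(u - u₀).re| ≤ ‖u - u₀‖ := Complex.abs_re_le_norm _
      rw [Metric.mem_ball, dist_eq_norm] at hu
      have := (abs_le.1 h1).1
      rw [Complex.sub_re] at this
      linarith
    refine mul_le_mul ?_ ?_ (norm_nonneg _)
      (Finset.prod_nonneg fun j _ => Real.rpow_nonneg (hσ j).1.le _)
    · refine Finset.prod_le_prod (fun j _ => Real.rpow_nonneg (hσ j).1.le _) fun j _ => ?_
      refine Real.rpow_le_rpow_of_exponent_ge (hσ j).1 (hσ j).2.le ?_
      rw [re_natCast_mul_sub_intCast]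
      gcongr
    · exact hC (u, fun j => (σ j : ℂ)) ⟨Metric.ball_subset_closedBall hu,
        ofReal_mem_realCube fun j => Set.Ioo_subset_Icc_self (hσ j)⟩

theorem mder_zero_exponent {n : ℕ} (h : (Fin n → ℂ) → ℂ) : mder (fun _ => 0) h = h := by
  rw [mder]
  induction List.finRange n with
  | nil => rfl
  | cons i L ih => exact ih

/-- `A` continues `u ↦ ∫ ∏ σ_j^{p_j u - m_j - 1} G(u, σ)` meromorphically to `Re u > -δ`. -/
def IsMellinContinuation {n : ℕ} (δ : ℝ) (p : Fin n → ℕ) (m : Fin n → ℤ)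
    (G : ℂ → (Fin n → ℂ) → ℂ) (A : ℂ → ℂ) : Prop :=
  MeromorphicOn A {u : ℂ | -δ < u.re} ∧
    ∀ u : ℂ, -δ < u.re → (∀ j, 0 < (p j : ℝ) * u.re - m j) →
      A u = cubeMellin (fun j => (p j : ℂ) * u - m j) (G u)

theorem card_filter_update {n : ℕ} (m : Fin n → ℤ) (j : Fin n) (hj : 0 ≤ m j) {x : ℤ}
    (hx : x < 0) : (Finset.univ.filter fun i => 0 ≤ m i).card =
      (Finset.univ.filter fun i => 0 ≤ Function.update m j x i).card + 1 := by
  have h : (Finset.univ.filter fun i => 0 ≤ Function.update m j x i) =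
      (Finset.univ.filter fun i => 0 ≤ m i).erase j := by
    ext i
    by_cases hi : i = j
    · subst hi
      simpa using hx
    · simp [hi]
  rw [h, Finset.card_erase_add_one (by simpa using hj)]

theorem sum_toNat_update_lt {n : ℕ} (m : Fin n → ℤ) (j : Fin n) (hj : 0 ≤ m j) {x : ℤ}
    (hx : x < m j) : ∑ i, (Function.update m j x i + 1).toNat < ∑ i, (m i + 1).toNat := by
  refine Finset.sum_lt_sum (fun i _ => ?_) ⟨j, Finset.mem_univ j, ?_⟩
  · by_cases hi : i = j
    · subst hi
      rw [Function.update_self]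
      omega
    · rw [Function.update_of_ne hi]
  · rw [Function.update_self]
    omega

theorem IsMellinContinuation.div {n : ℕ} {δ : ℝ} {p : Fin n → ℕ} {m : Fin n → ℤ}
    {G : ℂ → (Fin n → ℂ) → ℂ} {j : Fin n} {A A' : ℂ → ℂ}
    (hG : AnalyticOnNhd ℂ (fun p : ℂ × (Fin n → ℂ) => G p.1 p.2) (Set.univ ×ˢ realCube n))
    (hA : IsMellinContinuation δ (Function.update p j 0) (Function.update m j (-1))
      (fun u σ => G u (Function.update σ j 1)) A)
    (hA' : IsMellinContinuation δ p (Function.update m j (m j - 1))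
      (fun u => pder j (G u)) A') :
    IsMellinContinuation δ p m G fun u => (A u - A' u) / ((p j : ℂ) * u - m j) := by
  refine ⟨(hA.1.sub hA'.1).div (AnalyticOnNhd.meromorphicOn fun u _ => by fun_prop), ?_⟩
  intro u hu hz
  have hz' : ∀ i, 0 < ((p i : ℂ) * u - m i).re := fun i => by
    rw [re_natCast_mul_sub_intCast]
    exact hz i
  have hzj : (p j : ℂ) * u - m j ≠ 0 := fun h => by
    have := hz' j
    simp [h] at this
  have e1 : (fun i => ((Function.update p j 0 i : ℕ) : ℂ) * u -
      (Function.update m j (-1) i : ℤ)) =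
      Function.update (fun i => (p i : ℂ) * u - m i) j 1 := by
    funext i
    by_cases hi : i = j
    · subst hi
      simp
    · simp [hi]
  have e2 : (fun i => (p i : ℂ) * u - (Function.update m j (m j - 1) i : ℤ)) =
      Function.update (fun i => (p i : ℂ) * u - m i) j ((p j : ℂ) * u - m j + 1) := by
    funext i
    by_cases hi : i = j
    · subst hi
      simp
      ring
    · simp [hi]
  have h1 := hA.2 u hu fun i => by
    by_cases hi : i = j
    · subst hi
      simp
    · simpa [hi] using hz i
  have h2 := hA'.2 u hu fun i => by
    by_cases hi : i = j
    · subst hi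
      simp only [Function.update_self]
      push_cast
      linarith [hz i]
    · simpa [hi] using hz i
  rw [e1] at h1
  rw [e2] at h2
  simp only
  rw [h1, h2, div_eq_iff hzj, mul_comm (cubeMellin _ _)]
  exact (mul_cubeMellin hz' (analyticOnNhd_slice hG u) j).symm

theorem exists_isMellinContinuation {n : ℕ} (hn : 0 < n) {δ : ℝ} (hδ0 : 0 < δ) (k : ℕ) :
    ∀ (p : Fin n → ℕ) (m : Fin n → ℤ) (G : ℂ → (Fin n → ℂ) → ℂ),
      ∑ j, (m j + 1).toNat ≤ k → (∀ j, p j * δ < 1) → (∀ j, 0 ≤ m j → 0 < p j) →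
      AnalyticOnNhd ℂ (fun p : ℂ × (Fin n → ℂ) => G p.1 p.2) (Set.univ ×ˢ realCube n) →
      ∃ A L, IsMellinContinuation δ p m G A ∧
        Filter.Tendsto (fun u => u ^ (Finset.univ.filter fun j => 0 ≤ m j).card * A u)
          (nhdsWithin 0 {0}ᶜ) (nhds L) ∧
        ∀ m' : Fin n → ℕ, m = (fun j => (m' j : ℤ)) →
          L = (∏ j, (p j : ℂ)⁻¹) * (∏ j, ((m' j).factorial : ℂ)⁻¹) * mder m' (G 0) 0 := by
  have hid : Filter.Tendsto (fun u : ℂ => u) (nhdsWithin 0 {0}ᶜ) (nhds 0) := nhdsWithin_le_nhds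
  induction k with
  | zero =>
    intro p m G hk hδ hp hG
    have hm : ∀ j, m j ≤ -1 := by
      intro j
      have := (Finset.sum_eq_zero_iff.1 (Nat.le_zero.1 hk)) j (Finset.mem_univ j)
      omega
    have hd := differentiableOn_cubeMellin hδ hm hG
    have ho : IsOpen {u : ℂ | -δ < u.re} := isOpen_lt continuous_const continuous_re
    have hc : (Finset.univ.filter fun j => 0 ≤ m j).card = 0 := by
      rw [Finset.card_eq_zero, Finset.filter_eq_empty_iff]
      intro j _
      have := hm j
      omega
    refine ⟨_, cubeMellin (fun j => (p j : ℂ) * 0 - m j) (G 0),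
      ⟨(hd.analyticOnNhd ho).meromorphicOn, fun u _ _ => rfl⟩, ?_, ?_⟩
    · simp only [hc, pow_zero, one_mul]
      exact (hd.continuousOn.continuousAt (ho.mem_nhds (by simpa using hδ0))).tendsto.mono_left
        nhdsWithin_le_nhds
    · intro m' hm'
      have := hm ⟨0, hn⟩
      simp [hm'] at this
      omega
  | succ k ih =>
    intro p m G hk hδ hp hG
    by_cases hk' : ∑ j, (m j + 1).toNat ≤ k
    · exact ih p m G hk' hδ hp hG
    have hstep : ∀ j, 0 ≤ m j → ∃ (A : ℂ → ℂ) (L : ℂ) (A' : ℂ → ℂ) (L' : ℂ),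
        IsMellinContinuation δ p m G (fun u => (A u - A' u) / ((p j : ℂ) * u - m j)) ∧
        Filter.Tendsto (fun u => u ^ ((Finset.univ.filter fun j => 0 ≤ m j).card - 1) * A u)
          (nhdsWithin 0 {0}ᶜ) (nhds L) ∧
        Filter.Tendsto (fun u => u ^ (Finset.univ.filter fun i =>
          0 ≤ Function.update m j (m j - 1) i).card * A' u) (nhdsWithin 0 {0}ᶜ) (nhds L') ∧
        ∀ m' : Fin n → ℕ, Function.update m j (m j - 1) = (fun j => (m' j : ℤ)) →
          L' = (∏ j, (p j : ℂ)⁻¹) * (∏ j, ((m' j).factorial : ℂ)⁻¹) *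
            mder m' (pder j (G 0)) 0 := by
      intro j hj
      obtain ⟨A, L, hA, hL, -⟩ := ih (Function.update p j 0) (Function.update m j (-1))
        (fun u σ => G u (Function.update σ j 1))
        (by have := sum_toNat_update_lt m j hj (x := -1) (by omega); omega)
        (fun i => by
          by_cases hi : i = j
          · subst hi
            simp
          · simpa [hi] using hδ i)
        (fun i => by
          by_cases hi : i = j
          · subst hi
            simp
          · simpa [hi] using hp i) (analyticOnNhd_update_slice hG j)
      obtain ⟨A', L', hA', hL', hf⟩ := ih p (Function.update m j (m j - 1))
        (fun u => pder j (G u))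
        (by have := sum_toNat_update_lt m j hj (x := m j - 1) (by omega); omega) hδ
        (fun i => by
          by_cases hi : i = j
          · subst hi
            exact fun _ => hp i hj
          · simpa [hi] using hp i) (analyticOnNhd_pder_slice hG j)
      refine ⟨A, L, A', L', hA.div hG hA', ?_, hL', hf⟩
      rwa [card_filter_update m j hj (x := -1) (by omega), Nat.add_sub_cancel]
    by_cases hpos : ∃ j, 0 < m j
    · obtain ⟨j, hj⟩ := hpos
      obtain ⟨A, L, A', L', hA, hL, hL', hf⟩ := hstep j hj.le
      have hcard : (Finset.univ.filter fun i => 0 ≤ Function.update m j (m j - 1) i) =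
          Finset.univ.filter fun i => 0 ≤ m i := by
        ext i
        by_cases hi : i = j
        · subst hi
          simp
          omega
        · simp [hi]
      have hd : 0 < (Finset.univ.filter fun i => 0 ≤ m i).card :=
        Finset.card_pos.2 ⟨j, by simpa using hj.le⟩
      rw [hcard] at hL'
      have hmj : (m j : ℂ) ≠ 0 := by exact_mod_cast hj.ne'
      have hz : Filter.Tendsto (fun u : ℂ => (p j : ℂ) * u - m j) (nhdsWithin 0 {0}ᶜ)
          (nhds ((p j : ℂ) * 0 - m j)) := (hid.const_mul _).sub_const _
      refine ⟨_, (0 * L - L') / ((p j : ℂ) * 0 - m j), hA, ?_, ?_⟩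
      · refine (((hid.mul hL).sub hL').div hz (by simpa using hmj)).congr fun u => ?_
        rw [Pi.div_apply, ← mul_assoc, mul_pow_sub_one hd.ne']
        ring
      · intro m' hm'
        have hm'j : m' j ≠ 0 := by
          rw [hm'] at hj
          simp only at hj
          omega
        have hmz : (m j : ℂ) = (m' j : ℂ) := by simp [hm']
        rw [hf (Function.update m' j (m' j - 1)) (by
          funext i
          by_cases hi : i = j
          · subst hi
            simp only [hm', Function.update_self]
            omega
          · simp [hi, hm']),
          (mder_eventuallyEq_mder_pder ((analyticOnNhd_slice hG 0) 0 (zero_mem_realCube n))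
            hm'j).eq_of_nhds]
        have hfac : ∏ i, ((m' i).factorial : ℂ)⁻¹ = (m' j : ℂ)⁻¹ *
            ∏ i, ((Function.update m' j (m' j - 1) i).factorial : ℂ)⁻¹ := by
          rw [← Finset.mul_prod_erase _ _ (Finset.mem_univ j),
            ← Finset.mul_prod_erase _ (fun i => ((Function.update m' j (m' j - 1) i).factorial
              : ℂ)⁻¹) (Finset.mem_univ j), ← mul_assoc, Function.update_self,
            ← Nat.mul_factorial_pred hm'j]
          push_cast
          rw [mul_inv]
          congr 1
          refine Finset.prod_congr rfl fun i hi => ?_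
          rw [Function.update_of_ne (Finset.ne_of_mem_erase hi)]
        rw [hfac, hmz, mul_zero, zero_mul, zero_sub, zero_sub, neg_div_neg_eq, div_eq_inv_mul]
        ring
    · have hm0 : ∀ i, m i ≤ 0 := fun i => not_lt.1 fun h => hpos ⟨i, h⟩
      obtain ⟨j, hj⟩ : ∃ j, m j = 0 := by
        by_contra hne
        refine hk' ((Finset.sum_eq_zero fun i _ => ?_).le.trans (Nat.zero_le k))
        have h1 := hm0 i
        have h2 : m i ≠ 0 := fun h => hne ⟨i, h⟩
        omega
      obtain ⟨A, L, A', L', hA, hL, hL', -⟩ := hstep j hj.ge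
      have hd := card_filter_update m j hj.ge (x := m j - 1) (by omega)
      have hpj : (p j : ℂ) ≠ 0 := by exact_mod_cast (hp j hj.ge).ne'
      have hT : Filter.Tendsto (fun u => u ^ (Finset.univ.filter fun j => 0 ≤ m j).card *
          ((A u - A' u) / ((p j : ℂ) * u - m j)))
          (nhdsWithin 0 {0}ᶜ) (nhds ((L - L') / p j)) := by
        refine ((hL.sub hL').div_const _).congr' ?_
        filter_upwards [self_mem_nhdsWithin] with u hu
        have hu0 : u ≠ 0 := hu
        rw [hd, Nat.add_sub_cancel, hj]
        simp only [Int.cast_zero, sub_zero]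
        field_simp
        ring
      refine ⟨_, _, hA, hT, ?_⟩
      intro m' hm'
      have hm'0 : m' = fun _ => 0 := by
        funext i
        have := hm0 i
        rw [hm'] at this
        simp only at this
        omega
      subst hm'0
      have hp' : ∀ i, 0 < p i := fun i => hp i (by simp [hm'])
      have hT2 := hT.comp (tendsto_nhdsWithin_iff.2 ⟨(Complex.continuous_ofReal.tendsto' 0 0
        Complex.ofReal_zero).mono_left nhdsWithin_le_nhds, by
          filter_upwards [self_mem_nhdsWithin] with ε hε
          exact Complex.ofReal_ne_zero.2 (ne_of_gt hε)⟩ :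
        Filter.Tendsto (fun ε : ℝ => (ε : ℂ)) (nhdsWithin 0 (Set.Ioi 0)) (nhdsWithin 0 {0}ᶜ))
      have hT3 := tendsto_pow_mul_cubeMellin hp' hG
      rw [mder_zero_exponent]
      simp only [Nat.factorial_zero, Nat.cast_one, inv_one, Finset.prod_const_one, mul_one]
      refine tendsto_nhds_unique hT2 (hT3.congr' ?_)
      filter_upwards [self_mem_nhdsWithin] with ε hε
      have hε0 : (0 : ℝ) < ε := hε
      have h := hA.2 ε (by simpa using (neg_lt_zero.2 hδ0).trans hε0) fun i => by
        simpa [hm'] using mul_pos (Nat.cast_pos.2 (hp' i)) hε0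
      simp only [Function.comp_apply]
      simp only at h
      rw [h]
      simp [hm']

/-- Lebesgue measure on the open positive orthant. -/
def orthantMeasure (n : ℕ) : Measure (Fin n → ℝ) :=
  Measure.pi fun _ => volume.restrict (Set.Ioi (0 : ℝ))

instance (n : ℕ) : SigmaFinite (orthantMeasure n) := by
  unfold orthantMeasure
  infer_instance

theorem setOf_forall_pos_eq_pi (n : ℕ) :
    {t : Fin n → ℝ | ∀ i, 0 < t i} = Set.univ.pi fun _ => Set.Ioi (0 : ℝ) := by
  ext t
  simp

theorem measurableSet_forall_pos (n : ℕ) : MeasurableSet {t : Fin n → ℝ | ∀ i, 0 < t i} := by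
  rw [setOf_forall_pos_eq_pi]
  exact MeasurableSet.univ_pi fun _ => measurableSet_Ioi

theorem orthantMeasure_eq_restrict (n : ℕ) :
    orthantMeasure n = volume.restrict {t : Fin n → ℝ | ∀ i, 0 < t i} := by
  rw [setOf_forall_pos_eq_pi, volume_pi, Measure.restrict_pi_pi, orthantMeasure]

theorem ae_orthantMeasure (n : ℕ) : ∀ᵐ x ∂orthantMeasure n, ∀ j, 0 < x j := by
  rw [orthantMeasure_eq_restrict]
  exact ae_restrict_mem (measurableSet_forall_pos n)

/-- The integrand `∏ x_j^{s-1} e^{-w_j x_j} / ∏ ⟨a_i, x⟩`. -/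
def orthantIntegrand {N n : ℕ} (a : Fin N → Fin n → ℂ) (w : Fin n → ℂ) (s : ℂ)
    (x : Fin n → ℝ) : ℂ :=
  (∏ j, (x j : ℂ) ^ (s - 1) * cexp (-(w j * x j))) * ∏ i, (∑ j, a i j * (x j : ℂ))⁻¹

theorem HypH.re_nonneg {N n : ℕ} {a : Fin N → Fin n → ℂ} (hH : HypH a) (i : Fin N)
    (j : Fin n) : 0 ≤ (a i j).re := by
  rcases hH.1 i j with h | h
  · simp [h]
  · exact h.le

theorem HypH.re_add_sum_pos {N n : ℕ} {a : Fin N → Fin n → ℂ} (hH : HypH a) {w : Fin n → ℂ}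
    (hw : ∀ j, 0 < (w j).re) {t : Fin N → ℝ} (ht : ∀ i, 0 < t i) (j : Fin n) :
    0 < (w j + ∑ i, (t i : ℂ) * a i j).re := by
  rw [Complex.add_re, Complex.re_sum]
  refine add_pos_of_pos_of_nonneg (hw j) (Finset.sum_nonneg fun i _ => ?_)
  rw [Complex.re_ofReal_mul]
  exact mul_nonneg (ht i).le (hH.re_nonneg i j)

theorem HypH.le_re_sum {N n : ℕ} {a : Fin N → Fin n → ℂ} (hH : HypH a) {x : Fin n → ℝ}
    (hx : ∀ j, 0 < x j) (i : Fin N) (j : Fin n) :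
    (a i j).re * x j ≤ (∑ k, a i k * (x k : ℂ)).re := by
  rw [Complex.re_sum]
  have h := Finset.single_le_sum (f := fun k => (a i k * (x k : ℂ)).re) (s := Finset.univ)
    (fun k _ => by
      rw [Complex.re_mul_ofReal]
      exact mul_nonneg (hH.re_nonneg i k) (hx k).le) (Finset.mem_univ j)
  simpa [Complex.re_mul_ofReal] using h

theorem integral_cexp_neg_mul_Ioi {b : ℂ} (hb : 0 < b.re) :
    ∫ t in Set.Ioi (0 : ℝ), cexp (-(t * b)) = b⁻¹ := by
  have h := integral_cpow_mul_cexp_neg_mul_Ioi (s := 1) (by simp) hb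
  simpa [mul_comm b, Complex.cpow_neg_one] using h

/-- The common integrand in the Fubini exchange. -/
def gammaKernel {N n : ℕ} (a : Fin N → Fin n → ℂ) (w : Fin n → ℂ) (s : ℂ)
    (p : (Fin N → ℝ) × (Fin n → ℝ)) : ℂ :=
  (∏ j, (p.2 j : ℂ) ^ (s - 1) * cexp (-(w j * p.2 j))) *
    ∏ i, cexp (-((p.1 i : ℂ) * ∑ j, a i j * (p.2 j : ℂ)))

theorem gammaKernel_eq {N n : ℕ} (a : Fin N → Fin n → ℂ) (w : Fin n → ℂ) (s : ℂ)
    (t : Fin N → ℝ) (x : Fin n → ℝ) :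
    gammaKernel a w s (t, x) =
      ∏ j, (x j : ℂ) ^ (s - 1) * cexp (-((w j + ∑ i, (t i : ℂ) * a i j) * x j)) := by
  simp only [gammaKernel, Finset.prod_mul_distrib, ← Complex.exp_sum, mul_assoc,
    ← Complex.exp_add]
  congr 2
  simp only [add_mul, Finset.sum_neg_distrib, Finset.sum_add_distrib, Finset.mul_sum,
    Finset.sum_mul, neg_add]
  rw [Finset.sum_comm]
  simp only [mul_assoc]

theorem integral_gammaKernel_right {N n : ℕ} {a : Fin N → Fin n → ℂ} (hH : HypH a)
    {w : Fin n → ℂ} (hw : ∀ j, 0 < (w j).re) {s : ℂ} (hs : 0 < s.re) {t : Fin N → ℝ}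
    (ht : ∀ i, 0 < t i) :
    ∫ x, gammaKernel a w s (t, x) ∂orthantMeasure n =
      Gamma s ^ n * ∏ j, (w j + ∑ i, (t i : ℂ) * a i j) ^ (-s) := by
  simp only [gammaKernel_eq]
  rw [orthantMeasure, integral_fintype_prod_eq_prod (fun j (x : ℝ) =>
    (x : ℂ) ^ (s - 1) * cexp (-((w j + ∑ i, (t i : ℂ) * a i j) * x)))]
  rw [Finset.prod_congr rfl fun j _ =>
    integral_cpow_mul_cexp_neg_mul_Ioi hs (hH.re_add_sum_pos hw ht j)]
  rw [Finset.prod_mul_distrib, mul_comm]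
  simp

theorem re_sum_pos_of_hypH {N n : ℕ} {a : Fin N → Fin n → ℂ} (hH : HypH a) {x : Fin n → ℝ}
    (hx : ∀ j, 0 < x j) (i : Fin N) : 0 < (∑ k, a i k * (x k : ℂ)).re := by
  obtain ⟨j, hj⟩ := hH.2 i
  exact (mul_pos ((hH.1 i j).resolve_left hj) (hx j)).trans_le (hH.le_re_sum hx i j)

theorem integral_gammaKernel_left {N n : ℕ} {a : Fin N → Fin n → ℂ} (hH : HypH a)
    (w : Fin n → ℂ) (s : ℂ) {x : Fin n → ℝ} (hx : ∀ j, 0 < x j) :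
    ∫ t, gammaKernel a w s (t, x) ∂orthantMeasure N = orthantIntegrand a w s x := by
  simp only [gammaKernel, orthantIntegrand]
  rw [integral_const_mul, orthantMeasure, integral_fintype_prod_eq_prod (fun i (t : ℝ) =>
    cexp (-((t : ℂ) * ∑ j, a i j * (x j : ℂ))))]
  rw [Finset.prod_congr rfl fun i _ => integral_cexp_neg_mul_Ioi (re_sum_pos_of_hypH hH hx i)]

theorem norm_gammaKernel {N n : ℕ} (a : Fin N → Fin n → ℂ) (w : Fin n → ℂ) (s : ℂ)
    (t : Fin N → ℝ) {x : Fin n → ℝ} (hx : ∀ j, 0 < x j) :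
    ‖gammaKernel a w s (t, x)‖ =
      (∏ j, x j ^ (s.re - 1) * Real.exp (-((w j).re * x j))) *
        ∏ i, Real.exp (-(t i * (∑ j, a i j * (x j : ℂ)).re)) := by
  rw [gammaKernel, norm_mul, norm_prod, norm_prod]
  congr 1
  · refine Finset.prod_congr rfl fun j _ => ?_
    rw [norm_mul, Complex.norm_cpow_eq_rpow_re_of_pos (hx j), Complex.norm_exp]
    simp
  · refine Finset.prod_congr rfl fun i _ => ?_
    rw [Complex.norm_exp, Complex.neg_re, Complex.re_ofReal_mul]

theorem integrable_rpow_mul_exp_Ioi {c r : ℝ} (hc : 0 < c) (hr : 0 < r) :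
    IntegrableOn (fun x : ℝ => x ^ (c - 1) * Real.exp (-(r * x))) (Set.Ioi 0) := by
  have h := integrableOn_rpow_mul_exp_neg_mul_rpow (p := 1) (s := c - 1) (b := r)
    (by linarith) one_pos hr
  simpa using h

theorem integrable_gammaKernel {N n : ℕ} {a : Fin N → Fin n → ℂ} (hH : HypH a)
    {w : Fin n → ℂ} (hw : ∀ j, 0 < (w j).re) {s : ℂ} (hs : (N : ℝ) < s.re) :
    Integrable (gammaKernel a w s) ((orthantMeasure N).prod (orthantMeasure n)) := by
  have hm : Measurable (gammaKernel a w s) := by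
    unfold gammaKernel
    fun_prop
  have hexp : ∀ b : ℝ, 0 < b → Integrable (fun t : ℝ => Real.exp (-(t * b)))
      (volume.restrict (Set.Ioi (0 : ℝ))) := by
    intro b hb
    simpa [mul_comm, IntegrableOn] using integrable_rpow_mul_exp_Ioi one_pos hb
  have hexpi : ∀ b : ℝ, 0 < b → ∫ t in Set.Ioi (0 : ℝ), Real.exp (-(t * b)) = b⁻¹ := by
    intro b hb
    have h := Real.integral_rpow_mul_exp_neg_mul_Ioi one_pos hb
    simpa [mul_comm] using h
  rw [integrable_prod_iff' hm.aestronglyMeasurable]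
  constructor
  · filter_upwards [ae_orthantMeasure n] with x hx
    have hmx : Measurable fun t => gammaKernel a w s (t, x) := hm.comp (by fun_prop)
    rw [← integrable_norm_iff hmx.aestronglyMeasurable]
    simp only [norm_gammaKernel a w s _ hx]
    exact (Integrable.fintype_prod fun i => hexp _ (re_sum_pos_of_hypH hH hx i)).const_mul _
  · choose g hg using hH.2
    have hg' : ∀ i, 0 < (a i (g i)).re := fun i => (hH.1 i (g i)).resolve_left (hg i)
    set c : Fin n → ℕ := fun j => (Finset.univ.filter fun i => g i = j).card with hc
    have hcN : ∀ j, 0 < s.re - c j := by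
      intro j
      have : c j ≤ N := (Finset.card_le_univ _).trans (by simp)
      have : (c j : ℝ) ≤ N := by exact_mod_cast this
      linarith
    have hb : Integrable (fun x : Fin n → ℝ => (∏ j, x j ^ (s.re - c j - 1) *
        Real.exp (-((w j).re * x j))) * ∏ i, (a i (g i)).re⁻¹) (orthantMeasure n) :=
      (Integrable.fintype_prod fun j =>
        integrable_rpow_mul_exp_Ioi (hcN j) (hw j)).mul_const _
    refine hb.mono' (hm.norm.stronglyMeasurable.integral_prod_left).aestronglyMeasurable ?_
    filter_upwards [ae_orthantMeasure n] with x hx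
    simp only [norm_gammaKernel a w s _ hx]
    rw [integral_const_mul, orthantMeasure, integral_fintype_prod_eq_prod (fun i (t : ℝ) =>
      Real.exp (-(t * (∑ j, a i j * (x j : ℂ)).re))),
      Finset.prod_congr rfl fun i _ => hexpi _ (re_sum_pos_of_hypH hH hx i)]
    have hA : 0 ≤ ∏ j, x j ^ (s.re - 1) * Real.exp (-((w j).re * x j)) :=
      Finset.prod_nonneg fun j _ => mul_nonneg (Real.rpow_nonneg (hx j).le _) (Real.exp_nonneg _)
    have hB : 0 ≤ ∏ i, ((∑ j, a i j * (x j : ℂ)).re)⁻¹ :=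
      Finset.prod_nonneg fun i _ => inv_nonneg.2 (re_sum_pos_of_hypH hH hx i).le
    rw [Real.norm_of_nonneg (mul_nonneg hA hB)]
    have hB' : ∏ i, ((∑ j, a i j * (x j : ℂ)).re)⁻¹ ≤
        ∏ i, ((a i (g i)).re⁻¹ * (x (g i))⁻¹) := by
      refine Finset.prod_le_prod (fun i _ => inv_nonneg.2 (re_sum_pos_of_hypH hH hx i).le)
        fun i _ => ?_
      rw [← mul_inv]
      exact inv_anti₀ (mul_pos (hg' i) (hx _)) (hH.le_re_sum hx i (g i))
    refine (mul_le_mul_of_nonneg_left hB' hA).trans (le_of_eq ?_)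
    have hfib : ∏ i, (x (g i))⁻¹ = ∏ j, ((x j)⁻¹) ^ c j := by
      rw [← Finset.prod_fiberwise' Finset.univ g fun j => (x j)⁻¹]
      simp [hc]
    rw [Finset.prod_mul_distrib (f := fun i => (a i (g i)).re⁻¹), hfib, mul_left_comm,
      ← Finset.prod_mul_distrib, mul_comm]
    congr 1
    refine Finset.prod_congr rfl fun j _ => ?_
    rw [sub_right_comm, Real.rpow_sub (hx j) _ (c j : ℝ), Real.rpow_natCast, inv_pow]
    ring

/-- The Gamma-function representation of the zeta integral. -/
theorem Gamma_pow_mul_zetaIntegral {N n : ℕ} {a : Fin N → Fin n → ℂ} (hH : HypH a)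
    {w : Fin n → ℂ} (hw : ∀ j, 0 < (w j).re) {s : ℂ} (hs : (N : ℝ) < s.re) :
    Integrable (orthantIntegrand a w s) (orthantMeasure n) ∧
      Gamma s ^ n * zetaIntegral a s w = ∫ x, orthantIntegrand a w s x ∂orthantMeasure n := by
  have hs0 : 0 < s.re := (Nat.cast_nonneg N).trans_lt hs
  have hi := integrable_gammaKernel hH hw hs
  have he : (fun x => ∫ t, gammaKernel a w s (t, x) ∂orthantMeasure N)
      =ᵐ[orthantMeasure n] orthantIntegrand a w s := by
    filter_upwards [ae_orthantMeasure n] with x hx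
    exact integral_gammaKernel_left hH w s hx
  refine ⟨hi.integral_prod_right.congr he, ?_⟩
  rw [zetaIntegral, ← orthantMeasure_eq_restrict, ← integral_const_mul, ← integral_congr_ae he,
    ← integral_integral_swap (f := fun t x => gammaKernel a w s (t, x)) hi]
  refine integral_congr_ae ?_
  filter_upwards [ae_orthantMeasure N] with t ht
  exact (integral_gammaKernel_right hH hw hs0 ht).symm

theorem StrictMono.apply_eq_of_forall_le_exists {n Z : ℕ} {f : Fin n → ℕ} (hf : StrictMono f)
    (h : ∀ j : Fin n, (j : ℕ) ≤ Z → ∃ i, f i = j) (j : Fin n) (hj : (j : ℕ) ≤ Z) : f j = j := by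
  have hle : ∀ (m : ℕ) (i : Fin n), (i : ℕ) = m → m ≤ f i := by
    intro m
    induction m with
    | zero => intro i _; exact Nat.zero_le _
    | succ m ih =>
      intro i hi
      have := ih ⟨m, by omega⟩ rfl
      have h2 : f ⟨m, by omega⟩ < f i := hf (by rw [Fin.lt_def]; simp; omega)
      omega
  suffices ∀ (m : ℕ) (j : Fin n), (j : ℕ) = m → m ≤ Z → f j = m from this j j rfl hj
  intro m
  induction m using Nat.strong_induction_on with
  | _ m ih =>
    intro j hjm hm
    obtain ⟨i, hi⟩ := h j (hjm ▸ hm)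
    have h1 := hle i i rfl
    rcases h1.lt_or_eq with h2 | h2
    · have := ih i (by omega) i rfl (by omega)
      omega
    · have : i = j := Fin.ext (by omega)
      subst this
      omega

/-- The sector `u_0 > ⋯ > u_Z > 0`, `u_Z > u_k > 0` for `k > Z`. -/
def sector (n Z : ℕ) : Set (Fin n → ℝ) :=
  {u | (∀ k, 0 < u k) ∧ ∀ j k : Fin n, j < k → (j : ℕ) ≤ Z → u k < u j}

theorem measurableSet_sector (n Z : ℕ) : MeasurableSet (sector n Z) := by
  simp only [sector, Set.ofPred_and, Set.ofPred_forall]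
  refine MeasurableSet.inter (MeasurableSet.iInter fun k => measurableSet_lt (by fun_prop)
    (by fun_prop)) (MeasurableSet.iInter fun j => MeasurableSet.iInter fun k =>
      MeasurableSet.iInter fun _ => MeasurableSet.iInter fun _ =>
        measurableSet_lt (by fun_prop) (by fun_prop))

theorem exists_mem_InZset_comp_mem_sector {n Z : ℕ} {x : Fin n → ℝ} (hx : ∀ i, 0 < x i)
    (hinj : Function.Injective x) : ∃ γ ∈ InZset n Z, x ∘ γ ∈ sector n Z := by
  set γ₁ := Tuple.sort (fun i => -x i) with hγ₁
  have hanti : StrictMono ((fun i => -x i) ∘ γ₁) :=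
    (Tuple.monotone_sort _).strictMono_of_injective
      ((neg_injective.comp hinj).comp γ₁.injective)
  have hlt : ∀ i j, i < j → x (γ₁ j) < x (γ₁ i) := fun i j h => neg_lt_neg_iff.1 (hanti h)
  set κ : Fin n → ℕ := fun i => if (γ₁.symm i : ℕ) ≤ Z then (γ₁.symm i : ℕ) else n + i with hκ
  have hκinj : Function.Injective κ := by
    intro i j hij
    have h1 := (γ₁.symm i).isLt
    have h2 := (γ₁.symm j).isLt
    simp only [hκ] at hij
    split_ifs at hij with h3 h4 h4
    · exact γ₁.symm.injective (Fin.ext hij)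
    · omega
    · omega
    · exact Fin.ext (by omega)
  set γ := Tuple.sort κ with hγ
  have hmono : StrictMono (κ ∘ γ) :=
    (Tuple.monotone_sort κ).strictMono_of_injective (hκinj.comp γ.injective)
  have hval : ∀ j : Fin n, (j : ℕ) ≤ Z → κ (γ j) = j :=
    hmono.apply_eq_of_forall_le_exists fun j hj => ⟨γ.symm (γ₁ j), by simp [hκ, hj]⟩
  have heq : ∀ j : Fin n, (j : ℕ) ≤ Z → γ j = γ₁ j := by
    intro j hj
    have h := hval j hj
    simp only [hκ] at h
    split_ifs at h with h1
    · rw [← congrArg γ₁ (Fin.ext h), Equiv.apply_symm_apply]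
    · have := j.isLt
      omega
  refine ⟨γ, ?_, fun k => hx _, fun j k hjk hj => ?_⟩
  · simp only [InZset, Finset.mem_filter, Finset.mem_univ, true_and]
    intro i j hi hij
    have hge : ∀ k : Fin n, Z + 1 ≤ (k : ℕ) → κ (γ k) = n + γ k := by
      intro k hk
      simp only [hκ]
      rw [if_neg]
      intro h
      have h2 := heq (γ₁.symm (γ k)) h
      rw [Equiv.apply_symm_apply] at h2
      have := γ.injective h2
      omega
    have h3 : κ (γ i) < κ (γ j) := hmono hij
    rw [hge i hi, hge j (by have := Fin.lt_def.1 hij; omega)] at h3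
    exact Fin.lt_def.2 (by omega)
  · obtain ⟨m, hm⟩ := γ₁.surjective (γ k)
    simp only [Function.comp_apply]
    rw [heq j hj, ← hm]
    refine hlt _ _ (lt_of_not_ge fun hmj => ?_)
    have hmZ : (m : ℕ) ≤ Z := (Fin.le_def.1 hmj).trans hj
    rw [← heq m hmZ] at hm
    exact (lt_of_le_of_lt hmj hjk).ne (γ.injective hm)

theorem eq_of_comp_mem_sector {n Z : ℕ} {x : Fin n → ℝ} {γ γ' : Equiv.Perm (Fin n)}
    (hγ : γ ∈ InZset n Z) (hγ' : γ' ∈ InZset n Z) (h : x ∘ γ ∈ sector n Z)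
    (h' : x ∘ γ' ∈ sector n Z) : γ = γ' := by
  simp only [InZset, Finset.mem_filter, Finset.mem_univ, true_and] at hγ hγ'
  have key : ∀ {δ δ' : Equiv.Perm (Fin n)} {j : Fin n}, (∀ i < j, δ i = δ' i) →
      ∃ k, j ≤ k ∧ δ' j = δ k := by
    intro δ δ' j hij
    obtain ⟨k, hk⟩ := δ.surjective (δ' j)
    refine ⟨k, le_of_not_gt fun hkj => ?_, hk.symm⟩
    have := hij k hkj
    rw [hk] at this
    exact hkj.ne' (δ'.injective this)
  have main : ∀ (m : ℕ) (j : Fin n), (j : ℕ) = m → γ j = γ' j := by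
    intro m
    induction m using Nat.strong_induction_on with
    | _ m ih =>
      intro j hjm
      have hi : ∀ i < j, γ i = γ' i := fun i hi => ih i (by rw [← hjm]; exact hi) i rfl
      obtain ⟨k, hjk, hk⟩ := key hi
      obtain ⟨k', hjk', hk'⟩ := key fun i hij => (hi i hij).symm
      by_contra hne
      have h1 : j < k := lt_of_le_of_ne hjk fun e => hne (by rw [hk, ← e])
      have h2 : j < k' := lt_of_le_of_ne hjk' fun e => hne (by rw [hk', ← e])
      by_cases hj : (j : ℕ) ≤ Z
      · have h3 := h.2 j k h1 hj
        have h4 := h'.2 j k' h2 hj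
        rw [Function.comp_apply, Function.comp_apply, ← hk] at h3
        rw [Function.comp_apply, Function.comp_apply, ← hk'] at h4
        exact lt_asymm h3 h4
      · have h3 := hγ j k (by omega) h1
        have h4 := hγ' j k' (by omega) h2
        rw [← hk] at h3
        rw [← hk'] at h4
        exact lt_asymm h3 h4
  exact Equiv.ext fun j => main j j rfl

theorem ae_injective (n : ℕ) : ∀ᵐ x : Fin n → ℝ, Function.Injective x := by
  have h : ∀ i j : Fin n, i ≠ j → ∀ᵐ x : Fin n → ℝ, x i ≠ x j := by
    intro i j hij
    set S : Submodule ℝ (Fin n → ℝ) := LinearMap.ker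
      (LinearMap.proj (R := ℝ) (φ := fun _ : Fin n => ℝ) i - LinearMap.proj j) with hS
    have hT : S ≠ ⊤ := by
      intro h
      have : (Pi.single i 1 : Fin n → ℝ) ∈ S := h ▸ Submodule.mem_top
      simp [hS, hij.symm] at this
    have := Measure.addHaar_submodule volume S hT
    refine measure_mono_null (fun x hx => ?_) this
    simp only [Set.mem_compl_iff, Set.mem_ofPred_eq, not_not] at hx
    simp [hS, hx]
  have h2 : ∀ᵐ x : Fin n → ℝ, ∀ i j : Fin n, i ≠ j → x i ≠ x j := by
    simp only [ae_all_iff]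
    exact h
  filter_upwards [h2] with x hx i j hij
  by_contra hne
  exact hx i j hne hij

theorem forall_pos_ae_eq_iUnion_sector (n Z : ℕ) :
    ({t | ∀ i, 0 < t i} : Set (Fin n → ℝ)) =ᵐ[volume]
      ⋃ γ ∈ InZset n Z, {x | x ∘ γ ∈ sector n Z} := by
  filter_upwards [ae_injective n] with x hx
  refine propext ⟨fun h => ?_, fun h => ?_⟩
  · obtain ⟨γ, hγ, h2⟩ := exists_mem_InZset_comp_mem_sector (Z := Z) (fun i => h i) hx
    exact Set.mem_iUnion₂.2 ⟨γ, hγ, h2⟩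
  · obtain ⟨γ, hγ, h2⟩ := Set.mem_iUnion₂.1 h
    intro i
    simpa using h2.1 (γ.symm i)

theorem integral_orthantMeasure_eq_sum {n : ℕ} (Z : ℕ) {f : (Fin n → ℝ) → ℂ}
    (hf : Integrable f (orthantMeasure n)) :
    (∀ γ ∈ InZset n Z, IntegrableOn (fun u => f (u ∘ γ.symm)) (sector n Z)) ∧
      ∫ x, f x ∂orthantMeasure n =
        ∑ γ ∈ InZset n Z, ∫ u in sector n Z, f (u ∘ γ.symm) := by
  rw [orthantMeasure_eq_restrict] at hf ⊢
  have hc : ∀ (γ : Equiv.Perm (Fin n)) (u : Fin n → ℝ),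
      MeasurableEquiv.piCongrLeft (fun _ : Fin n => ℝ) γ u = u ∘ γ.symm := by
    intro γ u
    ext i
    obtain ⟨i, rfl⟩ := γ.surjective i
    rw [MeasurableEquiv.coe_piCongrLeft, Equiv.piCongrLeft_apply_apply]
    simp
  have hpre : ∀ γ : Equiv.Perm (Fin n),
      MeasurableEquiv.piCongrLeft (fun _ : Fin n => ℝ) γ ⁻¹' {x | x ∘ γ ∈ sector n Z} =
        sector n Z := by
    intro γ
    ext u
    simp only [Set.mem_preimage, hc, Set.mem_ofPred_eq]
    rw [Function.comp_assoc]
    simp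
  have hmeas : ∀ γ : Equiv.Perm (Fin n), MeasurableSet {x | x ∘ γ ∈ sector n Z} := by
    intro γ
    have : Measurable fun x : Fin n → ℝ => x ∘ γ :=
      measurable_pi_lambda _ fun i => measurable_pi_apply _
    exact this (measurableSet_sector n Z)
  have hi : ∀ γ ∈ InZset n Z, IntegrableOn f {x | x ∘ γ ∈ sector n Z} := by
    intro γ hγ
    have h : IntegrableOn f {t : Fin n → ℝ | ∀ i, 0 < t i} := hf
    refine h.mono_set fun x hx i => ?_
    simpa using hx.1 (γ.symm i)
  refine ⟨fun γ hγ => ?_, ?_⟩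
  · have h := ((volume_measurePreserving_piCongrLeft (fun _ : Fin n => ℝ)
      γ).integrableOn_comp_preimage (MeasurableEquiv.measurableEmbedding _)).2 (hi γ hγ)
    rw [hpre] at h
    refine h.congr_fun (fun u _ => ?_) (measurableSet_sector n Z)
    simp [hc]
  · rw [setIntegral_congr_set (forall_pos_ae_eq_iUnion_sector n Z),
      integral_biUnion_finset _ (fun γ _ => hmeas γ) ?_ hi]
    · refine Finset.sum_congr rfl fun γ _ => ?_
      rw [← (volume_measurePreserving_piCongrLeft (fun _ : Fin n => ℝ)
        γ).setIntegral_preimage_emb (MeasurableEquiv.measurableEmbedding _) f, hpre]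
      simp only [hc]
    · intro γ hγ γ' hγ' hne
      refine Set.disjoint_left.2 fun x hx hx' => hne ?_
      exact eq_of_comp_mem_sector hγ hγ' hx hx'

/-- The indices `r` for which `σ_r` divides the `k`-th coordinate of `T(σ)`. -/
def chain {n : ℕ} (Z : ℕ) (k : Fin n) : Finset (Fin n) :=
  Finset.univ.filter fun r : Fin n => (r : ℕ) ≤ k ∧ ((r : ℕ) ≤ Z ∨ r = k)

/-- The index preceding `k` in the sector change of variables. -/
def chainPred {n : ℕ} (Z : ℕ) (k : Fin n) : Fin n :=
  ⟨min ((k : ℕ) - 1) Z, lt_of_le_of_lt (min_le_left _ _) (by omega)⟩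

theorem chainPred_lt {n : ℕ} (Z : ℕ) {k : Fin n} (hk : (k : ℕ) ≠ 0) : chainPred Z k < k := by
  rw [Fin.lt_def]
  simp only [chainPred]
  omega

theorem chainPred_le {n : ℕ} (Z : ℕ) (k : Fin n) : (chainPred Z k : ℕ) ≤ Z := by
  simp [chainPred]

theorem self_mem_chain {n : ℕ} (Z : ℕ) (k : Fin n) : k ∈ chain Z k := by
  simp [chain]

theorem chain_erase_self {n : ℕ} (Z : ℕ) {k : Fin n} (hk : (k : ℕ) ≠ 0) :
    (chain Z k).erase k = chain Z (chainPred Z k) := by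
  ext r
  simp only [chain, chainPred, Finset.mem_erase, Finset.mem_filter, Finset.mem_univ, true_and,
    Fin.ext_iff]
  omega

theorem chain_zero {n : ℕ} (Z : ℕ) {k : Fin n} (hk : (k : ℕ) = 0) : chain Z k = {k} := by
  ext r
  simp only [chain, Finset.mem_filter, Finset.mem_univ, true_and, Finset.mem_singleton,
    Fin.ext_iff]
  omega

/-- The sector change of variables, on real points. -/
def realTmap {n : ℕ} (Z : ℕ) (σ : Fin n → ℝ) : Fin n → ℝ := fun k => ∏ r ∈ chain Z k, σ r

theorem realTmap_of_ne_zero {n : ℕ} (Z : ℕ) (σ : Fin n → ℝ) {k : Fin n} (hk : (k : ℕ) ≠ 0) :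
    realTmap Z σ k = σ k * realTmap Z σ (chainPred Z k) := by
  rw [realTmap, realTmap, ← chain_erase_self Z hk, Finset.mul_prod_erase _ _ (self_mem_chain Z k)]

theorem realTmap_zero {n : ℕ} (Z : ℕ) (σ : Fin n → ℝ) {k : Fin n} (hk : (k : ℕ) = 0) :
    realTmap Z σ k = σ k := by
  rw [realTmap, chain_zero Z hk, Finset.prod_singleton]

/-- The parameter domain of the sector change of variables. -/
def sectorDomain (n : ℕ) : Set (Fin n → ℝ) :=
  Set.univ.pi fun j : Fin n => if (j : ℕ) = 0 then Set.Ioi (0 : ℝ) else Set.Ioo 0 1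

theorem mem_sectorDomain {n : ℕ} {σ : Fin n → ℝ} :
    σ ∈ sectorDomain n ↔ ∀ j, 0 < σ j ∧ ((j : ℕ) ≠ 0 → σ j < 1) := by
  simp only [sectorDomain, Set.mem_univ_pi]
  refine forall_congr' fun j => ?_
  split_ifs with h <;> simp [h]

theorem measurableSet_sectorDomain (n : ℕ) : MeasurableSet (sectorDomain n) := by
  refine MeasurableSet.univ_pi fun j => ?_
  split_ifs
  exacts [measurableSet_Ioi, measurableSet_Ioo]

theorem realTmap_pos {n : ℕ} (Z : ℕ) {σ : Fin n → ℝ} (hσ : ∀ j, 0 < σ j) (k : Fin n) :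
    0 < realTmap Z σ k :=
  Finset.prod_pos fun r _ => hσ r

theorem realTmap_mem_sector {n : ℕ} (Z : ℕ) {σ : Fin n → ℝ} (hσ : σ ∈ sectorDomain n) :
    realTmap Z σ ∈ sector n Z := by
  rw [mem_sectorDomain] at hσ
  have hpos := realTmap_pos Z fun j => (hσ j).1
  refine ⟨hpos, ?_⟩
  intro j k hjk hj
  induction k using WellFoundedLT.induction with
  | _ k ih =>
    have hk : (k : ℕ) ≠ 0 := by have := Fin.lt_def.1 hjk; omega
    have h1 : realTmap Z σ k < realTmap Z σ (chainPred Z k) := by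
      rw [realTmap_of_ne_zero Z σ hk]
      exact mul_lt_of_lt_one_left (hpos _) ((hσ k).2 hk)
    have h2 : j ≤ chainPred Z k := by
      rw [Fin.le_def]
      have := Fin.lt_def.1 hjk
      simp only [chainPred]
      omega
    rcases h2.lt_or_eq with h3 | h3
    · exact h1.trans (ih _ (chainPred_lt Z hk) h3)
    · rwa [h3]

theorem injOn_realTmap (n Z : ℕ) : Set.InjOn (realTmap (n := n) Z) (sectorDomain n) := by
  intro σ hσ τ _ h
  rw [mem_sectorDomain] at hσ
  ext k
  have hk := congrFun h k
  by_cases h0 : (k : ℕ) = 0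
  · rwa [realTmap_zero Z _ h0, realTmap_zero Z _ h0] at hk
  · rw [realTmap_of_ne_zero Z _ h0, realTmap_of_ne_zero Z _ h0, ← congrFun h (chainPred Z k)] at hk
    exact mul_right_cancel₀ (realTmap_pos Z (fun j => (hσ j).1) _).ne' hk

theorem image_realTmap (n Z : ℕ) : realTmap Z '' sectorDomain n = sector n Z := by
  refine Set.Subset.antisymm (Set.image_subset_iff.2 fun σ hσ => realTmap_mem_sector Z hσ) ?_
  intro u hu
  set σ : Fin n → ℝ := fun k => if (k : ℕ) = 0 then u k else u k / u (chainPred Z k) with hσ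
  refine ⟨σ, mem_sectorDomain.2 fun j => ⟨?_, fun hj => ?_⟩, ?_⟩
  · simp only [hσ]
    split_ifs
    exacts [hu.1 j, div_pos (hu.1 j) (hu.1 _)]
  · simp only [hσ, if_neg hj]
    rw [div_lt_one (hu.1 _)]
    exact hu.2 _ _ (chainPred_lt Z hj) (chainPred_le Z j)
  · ext k
    induction k using WellFoundedLT.induction with
    | _ k ih =>
      by_cases h0 : (k : ℕ) = 0
      · rw [realTmap_zero Z _ h0]
        simp [hσ, h0]
      · rw [realTmap_of_ne_zero Z _ h0, ih _ (chainPred_lt Z h0)]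
        simp only [hσ, if_neg h0]
        exact div_mul_cancel₀ _ (hu.1 _).ne'

/-- The Jacobian determinant of the sector change of variables. -/
def jacobian {n : ℕ} (Z : ℕ) (σ : Fin n → ℝ) : ℝ :=
  ∏ k, ∏ r ∈ (chain Z k).erase k, σ r

theorem hasFDerivAt_realTmap {n : ℕ} (Z : ℕ) (σ : Fin n → ℝ) :
    ∃ T' : (Fin n → ℝ) →L[ℝ] (Fin n → ℝ), HasFDerivAt (realTmap Z) T' σ ∧
      T'.det = jacobian Z σ := by
  refine ⟨ContinuousLinearMap.pi fun k => ∑ r ∈ chain Z k,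
    (∏ q ∈ (chain Z k).erase r, σ q) • ContinuousLinearMap.proj (R := ℝ)
      (φ := fun _ : Fin n => ℝ) r, ?_, ?_⟩
  · rw [hasFDerivAt_pi]
    intro k
    exact HasFDerivAt.finsetProd fun r _ => hasFDerivAt_apply r σ
  · rw [ContinuousLinearMap.det, ← LinearMap.det_toMatrix', Matrix.det_of_isLowerTriangular]
    · refine Finset.prod_congr rfl fun k _ => ?_
      rw [LinearMap.toMatrix'_apply]
      simp [Finset.sum_apply, Pi.single_apply, self_mem_chain]
    · intro k j hkj
      rw [LinearMap.toMatrix'_apply]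
      have hkj' : k < j := hkj
      simp only [ContinuousLinearMap.coe_coe, ContinuousLinearMap.coe_pi',
        _root_.sum_apply, _root_.smul_apply,
        ContinuousLinearMap.proj_apply, smul_eq_mul, Pi.single_apply]
      refine Finset.sum_eq_zero fun r hr => ?_
      have : (r : ℕ) ≤ k := (Finset.mem_filter.1 hr).2.1
      rw [if_neg, mul_zero]
      rintro rfl
      have := Fin.lt_def.1 hkj'
      omega

theorem integral_sector_eq {n : ℕ} (Z : ℕ) {f : (Fin n → ℝ) → ℂ}
    (hf : IntegrableOn f (sector n Z)) :
    IntegrableOn (fun σ => (jacobian Z σ : ℂ) * f (realTmap Z σ)) (sectorDomain n) ∧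
      ∫ u in sector n Z, f u = ∫ σ in sectorDomain n, (jacobian Z σ : ℂ) * f (realTmap Z σ) := by
  choose T' hT' hdet using hasFDerivAt_realTmap (n := n) Z
  have hd : ∀ σ ∈ sectorDomain n, |(T' σ).det| • f (realTmap Z σ) =
      (jacobian Z σ : ℂ) * f (realTmap Z σ) := by
    intro σ hσ
    rw [hdet, abs_of_nonneg, Complex.real_smul]
    exact Finset.prod_nonneg fun k _ => Finset.prod_nonneg fun r _ =>
      (mem_sectorDomain.1 hσ r).1.le
  have hm := measurableSet_sectorDomain n
  rw [← image_realTmap n Z] at hf ⊢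
  constructor
  · rw [integrableOn_image_iff_integrableOn_abs_det_fderiv_smul volume hm
      (fun σ _ => (hT' σ).hasFDerivWithinAt) (injOn_realTmap n Z)] at hf
    exact hf.congr_fun hd hm
  · rw [integral_image_eq_integral_abs_det_fderiv_smul volume hm
      (fun σ _ => (hT' σ).hasFDerivWithinAt) (injOn_realTmap n Z)]
    exact setIntegral_congr_fun hm hd

theorem Tmap_eq_prod_chain {n : ℕ} (Z : ℕ) (σ : Fin n → ℂ) (k : Fin n) :
    Tmap Z σ k = ∏ r ∈ chain Z k, σ r := by
  unfold Tmap
  split_ifs with h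
  · refine Finset.prod_congr ?_ fun _ _ => rfl
    ext r
    simp only [chain, Finset.mem_filter, Finset.mem_univ, true_and, Fin.ext_iff]
    omega
  · rw [← Finset.mul_prod_erase _ _ (self_mem_chain Z k)]
    congr 1
    refine Finset.prod_congr ?_ fun _ _ => rfl
    ext r
    simp only [chain, Finset.mem_erase, Finset.mem_filter, Finset.mem_univ, true_and, Fin.ext_iff]
    omega

theorem ofReal_realTmap {n : ℕ} (Z : ℕ) (σ : Fin n → ℝ) (k : Fin n) :
    (realTmap Z σ k : ℂ) = Tmap Z (fun j => (σ j : ℂ)) k := by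
  rw [Tmap_eq_prod_chain, realTmap, Complex.ofReal_prod]

theorem mem_chain_of_eq_zero {n : ℕ} (Z : ℕ) {j₀ : Fin n} (h0 : (j₀ : ℕ) = 0) (k : Fin n) :
    j₀ ∈ chain Z k := by
  simp only [chain, Finset.mem_filter, Finset.mem_univ, true_and]
  omega

theorem Tmap_eq_mul_update {n : ℕ} (Z : ℕ) {j₀ : Fin n} (h0 : (j₀ : ℕ) = 0) (σ : Fin n → ℂ)
    (k : Fin n) : Tmap Z σ k = σ j₀ * Tmap Z (Function.update σ j₀ 1) k := by
  rw [Tmap_eq_prod_chain, Tmap_eq_prod_chain,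
    ← Finset.mul_prod_erase _ _ (mem_chain_of_eq_zero Z h0 k),
    ← Finset.mul_prod_erase _ _ (mem_chain_of_eq_zero Z h0 k), Function.update_self, one_mul]
  congr 1
  refine Finset.prod_congr rfl fun r hr => ?_
  rw [Function.update_of_ne (Finset.ne_of_mem_erase hr)]

/-- The number of coordinates of `T(σ)` divisible by `σ_r`. -/
def chainCount {n : ℕ} (Z : ℕ) (r : Fin n) : ℕ := if (r : ℕ) ≤ Z then n - r else 1

theorem card_filter_mem_chain {n : ℕ} (Z : ℕ) (r : Fin n) :
    (Finset.univ.filter fun k => r ∈ chain Z k).card = chainCount Z r := by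
  unfold chainCount
  split_ifs with h
  · rw [← Fin.card_Ici]
    congr 1
    ext k
    simp only [chain, Finset.mem_filter, Finset.mem_univ, true_and, Finset.mem_Ici, Fin.le_def]
    omega
  · rw [Finset.card_eq_one]
    refine ⟨r, ?_⟩
    ext k
    simp only [chain, Finset.mem_filter, Finset.mem_univ, true_and, Finset.mem_singleton,
      Fin.ext_iff]
    omega

theorem ofReal_prod_cpow {ι : Type*} (S : Finset ι) {x : ι → ℝ} (hx : ∀ i, 0 < x i) (s : ℂ) :
    (∏ i ∈ S, (x i : ℂ)) ^ s = ∏ i ∈ S, (x i : ℂ) ^ s := by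
  induction S using Finset.induction_on with
  | empty => simp
  | insert i S hi ih =>
    rw [Finset.prod_insert hi, Finset.prod_insert hi, ← ih, ← Complex.ofReal_prod,
      Complex.mul_cpow_ofReal_nonneg (hx i).le (Finset.prod_nonneg fun j _ => (hx j).le)]

theorem jacobian_mul_prod {n : ℕ} (Z : ℕ) (σ : Fin n → ℝ) :
    jacobian Z σ * ∏ k, σ k = ∏ k, realTmap Z σ k := by
  rw [jacobian, ← Finset.prod_mul_distrib]
  exact Finset.prod_congr rfl fun k _ => Finset.prod_erase_mul _ _ (self_mem_chain Z k)

theorem jacobian_mul_prod_cpow {n : ℕ} (Z : ℕ) {σ : Fin n → ℝ} (hσ : ∀ j, 0 < σ j) (s : ℂ) :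
    (jacobian Z σ : ℂ) * ∏ k, (realTmap Z σ k : ℂ) ^ (s - 1) =
      ∏ r, (σ r : ℂ) ^ ((chainCount Z r : ℂ) * s - 1) := by
  have h0 : ∀ r, (σ r : ℂ) ≠ 0 := fun r => Complex.ofReal_ne_zero.2 (hσ r).ne'
  have hT : ∀ r, (realTmap Z σ r : ℂ) ≠ 0 := fun r =>
    Complex.ofReal_ne_zero.2 (realTmap_pos Z hσ r).ne'
  have hP : (∏ k, (σ k : ℂ)) ≠ 0 := Finset.prod_ne_zero_iff.2 fun r _ => h0 r
  have hJ : (jacobian Z σ : ℂ) * ∏ k, (σ k : ℂ) = ∏ k, (realTmap Z σ k : ℂ) := by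
    rw [← Complex.ofReal_prod, ← Complex.ofReal_prod, ← Complex.ofReal_mul, jacobian_mul_prod]
  have hs : ∏ k, (realTmap Z σ k : ℂ) ^ s = ∏ r, (σ r : ℂ) ^ ((chainCount Z r : ℂ) * s) := by
    calc ∏ k, (realTmap Z σ k : ℂ) ^ s = ∏ k, ∏ r ∈ chain Z k, (σ r : ℂ) ^ s := by
          refine Finset.prod_congr rfl fun k _ => ?_
          rw [realTmap, Complex.ofReal_prod, ofReal_prod_cpow _ hσ]
      _ = ∏ r, ∏ k ∈ Finset.univ.filter (fun k => r ∈ chain Z k), (σ r : ℂ) ^ s :=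
          Finset.prod_comm' (by simp)
      _ = _ := by
          refine Finset.prod_congr rfl fun r _ => ?_
          rw [Finset.prod_const, card_filter_mem_chain, Complex.cpow_nat_mul]
  refine mul_right_cancel₀ hP ?_
  rw [mul_right_comm, hJ, ← Finset.prod_mul_distrib, ← Finset.prod_mul_distrib]
  refine Eq.trans (Finset.prod_congr rfl fun k _ => ?_)
    (hs.trans (Finset.prod_congr rfl fun r _ => ?_))
  · rw [Complex.cpow_sub _ _ (hT k), Complex.cpow_one, mul_div_cancel₀ _ (hT k)]
  · rw [Complex.cpow_sub _ _ (h0 r), Complex.cpow_one, div_mul_cancel₀ _ (h0 r)]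

/-- The number of rows whose first nonzero index lies in `[r, Z]`. -/
def rowCount {N n : ℕ} (a : Fin N → Fin n → ℂ) (Z : ℕ) (r : Fin n) : ℕ :=
  ∑ k ∈ Finset.univ.filter (fun k : Fin n => (r : ℕ) ≤ (k : ℕ) ∧ (k : ℕ) ≤ Z), (Fj a k).card

theorem alphav_eq {N n : ℕ} (a : Fin N → Fin n → ℂ) (Z l : ℕ) (r : Fin n) :
    alphav a Z l r = chainCount Z r * l + rowCount a Z r := by
  unfold alphav chainCount rowCount
  split_ifs with h
  · rfl
  · rw [Finset.filter_false_of_mem, Finset.sum_empty]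
    · simp
    · intro k _
      omega

theorem exists_mem_Fj {N n : ℕ} {a : Fin N → Fin n → ℂ} {Z : ℕ} (hZn : Z < n) (i : Fin N)
    (hi : (Finset.univ.filter fun j => a i j = 0).card ≤ Z) :
    ∃ j : Fin n, (j : ℕ) ≤ Z ∧ i ∈ Fj a j := by
  have h : ∃ j : Fin n, (j : ℕ) ≤ Z ∧ a i j ≠ 0 := by
    by_contra! h
    have h1 : Finset.Iic (⟨Z, hZn⟩ : Fin n) ⊆ Finset.univ.filter fun j => a i j = 0 := by
      intro j hj
      exact Finset.mem_filter.2 ⟨Finset.mem_univ _, h j (Fin.le_def.1 (Finset.mem_Iic.1 hj))⟩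
    have h2 := (Finset.card_le_card h1).trans hi
    rw [Fin.card_Iic] at h2
    exact absurd h2 (by simp)
  have h2 : ∃ m : ℕ, ∃ j : Fin n, (j : ℕ) = m ∧ (j : ℕ) ≤ Z ∧ a i j ≠ 0 := by
    obtain ⟨j, hj⟩ := h
    exact ⟨j, j, rfl, hj⟩
  obtain ⟨j, hj, hjZ, hne⟩ := Nat.find_spec h2
  refine ⟨j, hjZ, Finset.mem_filter.2 ⟨Finset.mem_univ _, fun k hk => ?_, hne⟩⟩
  by_contra hk0
  exact Nat.find_min h2 (hj ▸ hk) ⟨k, rfl, by omega, hk0⟩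

theorem eq_of_mem_Fj {N n : ℕ} {a : Fin N → Fin n → ℂ} {i : Fin N} {j k : Fin n}
    (hj : i ∈ Fj a j) (hk : i ∈ Fj a k) : j = k := by
  simp only [Fj, Finset.mem_filter, Finset.mem_univ, true_and] at hj hk
  rcases lt_trichotomy j k with h | h | h
  · exact absurd (hk.1 j h) hj.2
  · exact h
  · exact absurd (hj.1 k h) hk.2

theorem prod_Fj_eq_prod {N n : ℕ} {a : Fin N → Fin n → ℂ} {Z : ℕ}
    (h : ∀ i, ∃ j : Fin n, (j : ℕ) ≤ Z ∧ i ∈ Fj a j) {M : Type*} [CommMonoid M]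
    (f : Fin n → Fin N → M) (g : Fin N → M)
    (hfg : ∀ (j : Fin n) i, (j : ℕ) ≤ Z → i ∈ Fj a j → f j i = g i) :
    ∏ j ∈ Finset.univ.filter (fun j : Fin n => (j : ℕ) ≤ Z), ∏ i ∈ Fj a j, f j i = ∏ i, g i := by
  choose φ hφZ hφ using h
  rw [← Finset.prod_fiberwise_of_maps_to (s := Finset.univ) (g := φ)
    (t := Finset.univ.filter fun j : Fin n => (j : ℕ) ≤ Z) (fun i _ => by simpa using hφZ i)]
  refine Finset.prod_congr rfl fun j hj => ?_
  have hj' : (j : ℕ) ≤ Z := (Finset.mem_filter.1 hj).2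
  refine Finset.prod_congr ?_ fun i hi => ?_
  · ext i
    simp only [Finset.mem_filter, Finset.mem_univ, true_and]
    exact ⟨fun hi => eq_of_mem_Fj (hφ i) hi, fun hi => hi ▸ hφ i⟩
  · exact hfg j i hj' (by simp only [Finset.mem_filter] at hi; exact hi.2 ▸ hφ i)

theorem rowCount_zero {N n : ℕ} {a : Fin N → Fin n → ℂ} {Z : ℕ}
    (h : ∀ i, ∃ j : Fin n, (j : ℕ) ≤ Z ∧ i ∈ Fj a j) {j₀ : Fin n} (h0 : (j₀ : ℕ) = 0) :
    rowCount a Z j₀ = N := by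
  have := prod_Fj_eq_prod h (M := Multiplicative ℕ) (fun _ _ => Multiplicative.ofAdd 1)
    (fun _ => Multiplicative.ofAdd 1) fun _ _ _ _ => rfl
  simp only [Finset.prod_const, ← ofAdd_nsmul, smul_eq_mul, mul_one, ← ofAdd_sum] at this
  have := Multiplicative.ofAdd.injective this
  simpa [rowCount, h0] using this

theorem rowCount_le {N n : ℕ} {a : Fin N → Fin n → ℂ} {Z : ℕ}
    (h : ∀ i, ∃ j : Fin n, (j : ℕ) ≤ Z ∧ i ∈ Fj a j) (r : Fin n) : rowCount a Z r ≤ N := by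
  have hn : 0 < n := Nat.zero_lt_of_lt r.isLt
  refine le_trans ?_ (rowCount_zero h (j₀ := ⟨0, hn⟩) rfl).le
  rw [rowCount, rowCount]
  refine Finset.sum_le_sum_of_subset fun k => ?_
  simp only [Finset.mem_filter, Finset.mem_univ, true_and]
  omega

/-- The factor of `yfun` attached to the row `i`, whose first nonzero index is `j`. -/
def yfactor {N n : ℕ} (a : Fin N → Fin n → ℂ) (Z : ℕ) (j : Fin n) (i : Fin N)
    (σ : Fin n → ℂ) : ℂ :=
  a i j +
    (∑ k ∈ Finset.univ.filter (fun k : Fin n => (j : ℕ) < (k : ℕ) ∧ (k : ℕ) ≤ Z),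
      a i k * ∏ r ∈ Finset.univ.filter
        (fun r : Fin n => (j : ℕ) < (r : ℕ) ∧ (r : ℕ) ≤ (k : ℕ)), σ r) +
    (∑ k ∈ Finset.univ.filter (fun k : Fin n => Z < (k : ℕ)), a i k * σ k) *
      ∏ r ∈ Finset.univ.filter (fun r : Fin n => (j : ℕ) < (r : ℕ) ∧ (r : ℕ) ≤ Z), σ r

theorem yfun_eq {N n : ℕ} (a : Fin N → Fin n → ℂ) (Z : ℕ) (σ : Fin n → ℂ) :
    yfun a Z σ = ∏ j ∈ Finset.univ.filter (fun j : Fin n => (j : ℕ) ≤ Z),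
      ∏ i ∈ Fj a j, yfactor a Z j i σ := rfl

theorem prod_filter_le_mul {n : ℕ} (σ : Fin n → ℂ) {j : Fin n} {b : ℕ} (h : (j : ℕ) ≤ b) :
    (∏ r ∈ Finset.univ.filter (fun r : Fin n => (r : ℕ) ≤ (j : ℕ)), σ r) *
      (∏ r ∈ Finset.univ.filter (fun r : Fin n => (j : ℕ) < (r : ℕ) ∧ (r : ℕ) ≤ b), σ r) =
      ∏ r ∈ Finset.univ.filter (fun r : Fin n => (r : ℕ) ≤ b), σ r := by
  rw [← Finset.prod_union]
  · refine Finset.prod_congr ?_ fun _ _ => rfl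
    ext r
    simp only [Finset.mem_union, Finset.mem_filter, Finset.mem_univ, true_and]
    omega
  · refine Finset.disjoint_left.2 fun r hr hr' => ?_
    simp only [Finset.mem_filter, Finset.mem_univ, true_and] at hr hr'
    omega

theorem sum_mul_Tmap {N n : ℕ} {a : Fin N → Fin n → ℂ} {Z : ℕ} {j : Fin n} {i : Fin N}
    (hj : (j : ℕ) ≤ Z) (hi : i ∈ Fj a j) (σ : Fin n → ℂ) :
    ∑ k, a i k * Tmap Z σ k =
      (∏ r ∈ Finset.univ.filter (fun r : Fin n => (r : ℕ) ≤ (j : ℕ)), σ r) *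
        yfactor a Z j i σ := by
  have hlt : ∀ k : Fin n, (k : ℕ) < j → a i k = 0 := (Finset.mem_filter.1 hi).2.1
  have hsplit : ∀ f : Fin n → ℂ, (∀ k : Fin n, (k : ℕ) < j → f k = 0) →
      ∑ k, f k = f j +
        (∑ k ∈ Finset.univ.filter (fun k : Fin n => (j : ℕ) < (k : ℕ) ∧ (k : ℕ) ≤ Z), f k) +
        ∑ k ∈ Finset.univ.filter (fun k : Fin n => Z < (k : ℕ)), f k := by
    intro f hf
    have hfj : f j = ∑ k, if k = j then f k else 0 := by simp
    rw [Finset.sum_filter, Finset.sum_filter, hfj, ← Finset.sum_add_distrib,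
      ← Finset.sum_add_distrib]
    refine Finset.sum_congr rfl fun k _ => ?_
    by_cases h1 : k = j
    · subst h1
      simp [hj.not_gt]
    · have h1' : (k : ℕ) ≠ j := fun e => h1 (Fin.ext e)
      by_cases h2 : (k : ℕ) < j
      · rw [hf k h2]
        simp
      · by_cases h3 : (k : ℕ) ≤ Z
        · simp [h1, h3, show (j : ℕ) < k by omega, h3.not_gt]
        · simp [h1, h3, show Z < (k : ℕ) by omega]
  rw [hsplit _ fun k hk => by rw [hlt k hk, zero_mul], yfactor, mul_add, mul_add]
  congr 1
  · congr 1
    · rw [Tmap, if_pos hj, mul_comm]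
    · rw [Finset.mul_sum]
      refine Finset.sum_congr rfl fun k hk => ?_
      simp only [Finset.mem_filter, Finset.mem_univ, true_and] at hk
      rw [Tmap, if_pos hk.2, ← prod_filter_le_mul σ hk.1.le]
      ring
  · rw [mul_left_comm, prod_filter_le_mul σ hj, Finset.sum_mul]
    refine Finset.sum_congr rfl fun k hk => ?_
    simp only [Finset.mem_filter, Finset.mem_univ, true_and] at hk
    rw [Tmap, if_neg (by omega)]
    ring

theorem prod_sum_mul_Tmap {N n : ℕ} {a : Fin N → Fin n → ℂ} {Z : ℕ}
    (h : ∀ i, ∃ j : Fin n, (j : ℕ) ≤ Z ∧ i ∈ Fj a j) (σ : Fin n → ℂ) :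
    ∏ i, ∑ k, a i k * Tmap Z σ k = (∏ r, σ r ^ rowCount a Z r) * yfun a Z σ := by
  rw [← prod_Fj_eq_prod h (fun j i => (∏ r ∈ Finset.univ.filter
    (fun r : Fin n => (r : ℕ) ≤ (j : ℕ)), σ r) * yfactor a Z j i σ) _
    fun j i hj hi => (sum_mul_Tmap hj hi σ).symm, yfun_eq]
  simp only [Finset.prod_mul_distrib]
  congr 1
  simp only [Finset.prod_const, ← Finset.prod_pow]
  rw [Finset.prod_comm' (t' := Finset.univ) (s' := fun r : Fin n => Finset.univ.filter
    (fun k : Fin n => (r : ℕ) ≤ (k : ℕ) ∧ (k : ℕ) ≤ Z)) (by simp; tauto)]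
  refine Finset.prod_congr rfl fun r _ => ?_
  rw [Finset.prod_pow_eq_pow_sum, rowCount]

theorem mem_realCube_iff {n : ℕ} {σ : Fin n → ℂ} :
    σ ∈ realCube n ↔ ∃ τ : Fin n → ℝ, (∀ j, τ j ∈ Set.Icc (0 : ℝ) 1) ∧ σ = fun j => (τ j : ℂ) := by
  constructor
  · intro h
    choose τ hτ hτ' using fun j => h j (Set.mem_univ j)
    exact ⟨τ, hτ, funext fun j => (hτ' j).symm⟩
  · rintro ⟨τ, hτ, rfl⟩ j _
    exact ⟨τ j, hτ j, rfl⟩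

theorem exists_prod_eq_ofReal {n : ℕ} {σ : Fin n → ℂ} (hσ : σ ∈ realCube n) (S : Finset (Fin n)) :
    ∃ t : ℝ, 0 ≤ t ∧ ∏ r ∈ S, σ r = t := by
  obtain ⟨τ, hτ, rfl⟩ := mem_realCube_iff.1 hσ
  exact ⟨∏ r ∈ S, τ r, Finset.prod_nonneg fun r _ => (hτ r).1, by simp⟩

theorem yfactor_re_pos {N n : ℕ} {a : Fin N → Fin n → ℂ} (hH : HypH a) (Z : ℕ) {j : Fin n}
    {i : Fin N} (hi : i ∈ Fj a j) {σ : Fin n → ℂ} (hσ : σ ∈ realCube n) :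
    0 < (yfactor a Z j i σ).re := by
  have h1 : 0 < (a i j).re := (hH.1 i j).resolve_left (Finset.mem_filter.1 hi).2.2
  rw [yfactor, Complex.add_re, Complex.add_re, add_assoc]
  refine add_pos_of_pos_of_nonneg h1 (add_nonneg ?_ ?_)
  · rw [Complex.re_sum]
    refine Finset.sum_nonneg fun k _ => ?_
    obtain ⟨t, ht, hte⟩ := exists_prod_eq_ofReal hσ
      (Finset.univ.filter fun r : Fin n => (j : ℕ) < (r : ℕ) ∧ (r : ℕ) ≤ (k : ℕ))
    rw [hte, Complex.re_mul_ofReal]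
    exact mul_nonneg (hH.re_nonneg i k) ht
  · obtain ⟨t, ht, hte⟩ := exists_prod_eq_ofReal hσ
      (Finset.univ.filter fun r : Fin n => (j : ℕ) < (r : ℕ) ∧ (r : ℕ) ≤ Z)
    rw [hte, Complex.re_mul_ofReal, Complex.re_sum]
    refine mul_nonneg (Finset.sum_nonneg fun k _ => ?_) ht
    obtain ⟨τ, hτ, rfl⟩ := mem_realCube_iff.1 hσ
    rw [Complex.re_mul_ofReal]
    exact mul_nonneg (hH.re_nonneg i k) (hτ k).1

theorem yfun_ne_zero {N n : ℕ} {a : Fin N → Fin n → ℂ} (hH : HypH a) (Z : ℕ) {σ : Fin n → ℂ}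
    (hσ : σ ∈ realCube n) : yfun a Z σ ≠ 0 := by
  rw [yfun_eq]
  refine Finset.prod_ne_zero_iff.2 fun j _ => Finset.prod_ne_zero_iff.2 fun i hi h => ?_
  have := yfactor_re_pos hH Z hi hσ
  simp [h] at this

theorem yfun_update {N n : ℕ} (a : Fin N → Fin n → ℂ) (Z : ℕ) {j₀ : Fin n} (h0 : (j₀ : ℕ) = 0)
    (σ : Fin n → ℂ) (t : ℂ) : yfun a Z (Function.update σ j₀ t) = yfun a Z σ := by
  have hne : ∀ r : Fin n, 0 < (r : ℕ) → Function.update σ j₀ t r = σ r := fun r hr =>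
    Function.update_of_ne (fun e => by rw [e] at hr; omega) _ _
  have hprod : ∀ (j : Fin n) (b : ℕ),
      ∏ r ∈ Finset.univ.filter (fun r : Fin n => (j : ℕ) < (r : ℕ) ∧ (r : ℕ) ≤ b),
        Function.update σ j₀ t r =
      ∏ r ∈ Finset.univ.filter (fun r : Fin n => (j : ℕ) < (r : ℕ) ∧ (r : ℕ) ≤ b), σ r := by
    intro j b
    refine Finset.prod_congr rfl fun r hr => hne r ?_
    have := (Finset.mem_filter.1 hr).2.1
    omega
  rw [yfun_eq, yfun_eq]
  refine Finset.prod_congr rfl fun j _ => Finset.prod_congr rfl fun i _ => ?_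
  simp only [yfactor, hprod]
  congr 2
  refine Finset.sum_congr rfl fun k hk => ?_
  rw [hne k]
  have := (Finset.mem_filter.1 hk).2
  omega

theorem contDiff_yfun {N n : ℕ} (a : Fin N → Fin n → ℂ) (Z : ℕ) {k : WithTop ℕ∞} :
    ContDiff ℂ k (yfun a Z) := by
  unfold yfun
  fun_prop

/-- The linear form `∑ w_k T_k / σ_0`. -/
def linTail {n : ℕ} (w : Fin n → ℂ) (Z : ℕ) (j₀ : Fin n) (σ : Fin n → ℂ) : ℂ :=
  ∑ k, w k * Tmap Z (Function.update σ j₀ 1) k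

theorem sum_mul_Tmap_eq_linTail {n : ℕ} (w : Fin n → ℂ) (Z : ℕ) {j₀ : Fin n} (h0 : (j₀ : ℕ) = 0)
    (σ : Fin n → ℂ) : ∑ k, w k * Tmap Z σ k = σ j₀ * linTail w Z j₀ σ := by
  rw [linTail, Finset.mul_sum]
  refine Finset.sum_congr rfl fun k _ => ?_
  rw [Tmap_eq_mul_update Z h0]
  ring

theorem linTail_update {n : ℕ} (w : Fin n → ℂ) (Z : ℕ) (j₀ : Fin n) (σ : Fin n → ℂ) (t : ℂ) :
    linTail w Z j₀ (Function.update σ j₀ t) = linTail w Z j₀ σ := by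
  simp [linTail]

theorem contDiff_linTail {n : ℕ} (w : Fin n → ℂ) (Z : ℕ) (j₀ : Fin n) {k : WithTop ℕ∞} :
    ContDiff ℂ k (linTail w Z j₀) := by
  have hu : ∀ r : Fin n, ContDiff ℂ k fun σ : Fin n → ℂ => Function.update σ j₀ 1 r := by
    intro r
    by_cases h : r = j₀
    · subst h
      simp only [Function.update_self]
      exact contDiff_const
    · simp only [Function.update_of_ne h]
      fun_prop
  unfold linTail
  simp only [Tmap_eq_prod_chain]
  exact ContDiff.sum fun k _ => contDiff_const.mul (contDiff_prod fun r _ => hu r)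

theorem linTail_re_pos {n : ℕ} {w : Fin n → ℂ} (hw : ∀ j, 0 < (w j).re) (Z : ℕ) {j₀ : Fin n}
    (h0 : (j₀ : ℕ) = 0) {σ : Fin n → ℂ} (hσ : σ ∈ realCube n) : 0 < (linTail w Z j₀ σ).re := by
  have hσ' : Function.update σ j₀ 1 ∈ realCube n := by
    obtain ⟨τ, hτ, rfl⟩ := mem_realCube_iff.1 hσ
    refine mem_realCube_iff.2 ⟨Function.update τ j₀ 1, fun j => ?_, ?_⟩
    · by_cases h : j = j₀
      · subst h
        simp
      · rw [Function.update_of_ne h]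
        exact hτ j
    · ext j
      by_cases h : j = j₀
      · subst h
        simp
      · simp [Function.update_of_ne h]
  rw [linTail, Complex.re_sum]
  have hnn : ∀ k, 0 ≤ (w k * Tmap Z (Function.update σ j₀ 1) k).re := by
    intro k
    rw [Tmap_eq_prod_chain]
    obtain ⟨t, ht, hte⟩ := exists_prod_eq_ofReal hσ' (chain Z k)
    rw [hte, Complex.re_mul_ofReal]
    exact mul_nonneg (hw k).le ht
  have h1 := Finset.single_le_sum (fun k _ => hnn k) (Finset.mem_univ j₀)
  refine lt_of_lt_of_le ?_ h1
  rw [Tmap_eq_prod_chain, chain_zero Z h0]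
  simpa using hw j₀

/-- The analytic amplitude on the cube. -/
def amplitude {N n : ℕ} (a : Fin N → Fin n → ℂ) (w : Fin n → ℂ) (Z : ℕ) (j₀ : Fin n) (e : ℂ)
    (σ : Fin n → ℂ) : ℂ :=
  linTail w Z j₀ σ ^ e / yfun a Z σ

theorem amplitude_update {N n : ℕ} (a : Fin N → Fin n → ℂ) (w : Fin n → ℂ) (Z : ℕ) {j₀ : Fin n}
    (h0 : (j₀ : ℕ) = 0) (e : ℂ) (σ : Fin n → ℂ) (t : ℂ) :
    amplitude a w Z j₀ e (Function.update σ j₀ t) = amplitude a w Z j₀ e σ := by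
  rw [amplitude, amplitude, linTail_update, yfun_update a Z h0]

theorem analyticOnNhd_amplitude {N n : ℕ} {a : Fin N → Fin n → ℂ} (hH : HypH a) {w : Fin n → ℂ}
    (hw : ∀ j, 0 < (w j).re) (Z : ℕ) {j₀ : Fin n} (h0 : (j₀ : ℕ) = 0) {e : ℂ → ℂ}
    (he : ∀ u, AnalyticAt ℂ e u) :
    AnalyticOnNhd ℂ (fun p : ℂ × (Fin n → ℂ) => amplitude a w Z j₀ (e p.1) p.2)
      (Set.univ ×ˢ realCube n) := by
  rintro ⟨u, σ⟩ ⟨_, hσ⟩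
  have h1 : AnalyticAt ℂ (fun p : ℂ × (Fin n → ℂ) => linTail w Z j₀ p.2) (u, σ) :=
    AnalyticAt.comp (g := linTail w Z j₀) (contDiff_linTail w Z j₀).contDiffAt.analyticAt
      analyticAt_snd
  have h2 : AnalyticAt ℂ (fun p : ℂ × (Fin n → ℂ) => yfun a Z p.2) (u, σ) :=
    AnalyticAt.comp (g := yfun a Z) (contDiff_yfun a Z).contDiffAt.analyticAt analyticAt_snd
  have h3 : AnalyticAt ℂ (fun p : ℂ × (Fin n → ℂ) => e p.1) (u, σ) :=
    AnalyticAt.comp (g := e) (he u) analyticAt_fst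
  exact (h1.cpow h3 (Or.inl (linTail_re_pos hw Z h0 hσ))).div h2 (yfun_ne_zero hH Z hσ)

theorem pder_eq_zero_of_update_invariant {n : ℕ} {G : (Fin n → ℂ) → ℂ} {j : Fin n}
    (h : ∀ σ t, G (Function.update σ j t) = G σ) : pder j G = 0 := by
  ext σ
  rw [pder]
  by_cases hd : DifferentiableAt ℂ G σ
  · rw [← hd.lineDeriv_eq_fderiv, lineDeriv]
    have : (fun t : ℂ => G (σ + t • Pi.single j 1)) = fun _ => G σ := by
      funext t
      rw [← h σ (σ j + t)]
      congr 1
      ext i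
      by_cases hi : i = j
      · subst hi
        simp
      · simp [hi]
    rw [this, deriv_const]
    rfl
  · rw [fderiv_zero_of_not_differentiableAt hd]
    rfl

/-- The pulled back integrand of the sector. -/
def sectorIntegrand {N n : ℕ} (a : Fin N → Fin n → ℂ) (w : Fin n → ℂ) (Z : ℕ) (j₀ : Fin n) (s : ℂ)
    (σ : Fin n → ℝ) : ℂ :=
  (∏ r, (σ r : ℂ) ^ ((chainCount Z r : ℂ) * s - rowCount a Z r - 1)) *
    cexp (-(linTail w Z j₀ (fun j => (σ j : ℂ)) * σ j₀)) * (yfun a Z fun j => (σ j : ℂ))⁻¹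

theorem jacobian_mul_orthantIntegrand {N n : ℕ} {a : Fin N → Fin n → ℂ} (w : Fin n → ℂ) {Z : ℕ}
    (h : ∀ i, ∃ j : Fin n, (j : ℕ) ≤ Z ∧ i ∈ Fj a j) {j₀ : Fin n} (h0 : (j₀ : ℕ) = 0) (s : ℂ)
    {σ : Fin n → ℝ} (hσ : ∀ j, 0 < σ j) :
    (jacobian Z σ : ℂ) * orthantIntegrand a w s (realTmap Z σ) =
      sectorIntegrand a w Z j₀ s σ := by
  have hne : ∀ r, (σ r : ℂ) ≠ 0 := fun r => Complex.ofReal_ne_zero.2 (hσ r).ne'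
  rw [orthantIntegrand, Finset.prod_mul_distrib, ← Complex.exp_sum, Finset.sum_neg_distrib,
    Finset.prod_inv_distrib, ← mul_assoc, ← mul_assoc, jacobian_mul_prod_cpow Z hσ s]
  simp only [ofReal_realTmap]
  rw [sum_mul_Tmap_eq_linTail w Z h0, prod_sum_mul_Tmap h, mul_inv, sectorIntegrand,
    mul_comm (linTail w Z j₀ _)]
  have hp : ∏ r, (σ r : ℂ) ^ ((chainCount Z r : ℂ) * s - rowCount a Z r - 1) =
      (∏ r, (σ r : ℂ) ^ ((chainCount Z r : ℂ) * s - 1)) * (∏ r, (σ r : ℂ) ^ rowCount a Z r)⁻¹ := by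
    rw [← Finset.prod_inv_distrib, ← Finset.prod_mul_distrib]
    refine Finset.prod_congr rfl fun r _ => ?_
    rw [sub_right_comm, Complex.cpow_sub _ _ (hne r), Complex.cpow_natCast, div_eq_mul_inv]
  rw [hp]
  ring

theorem integral_sector_orthantIntegrand {N n : ℕ} {a : Fin N → Fin n → ℂ} (hH : HypH a)
    {w : Fin n → ℂ} (hw : ∀ j, 0 < (w j).re) {Z : ℕ}
    (h : ∀ i, ∃ j : Fin n, (j : ℕ) ≤ Z ∧ i ∈ Fj a j) {j₀ : Fin n} (h0 : (j₀ : ℕ) = 0) (l : ℕ)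
    {s : ℂ} (hs : (N : ℝ) < s.re) (hInt : IntegrableOn (orthantIntegrand a w s) (sector n Z)) :
    ∫ u in sector n Z, orthantIntegrand a w s u =
      Gamma (n * s - N) * ((s + l) * cubeMellin
        (fun j => ((if j = j₀ then 1 else chainCount Z j : ℕ) : ℂ) * (s + l) -
          ((if j = j₀ then 0 else alphav a Z l j : ℕ) : ℂ))
        (amplitude a w Z j₀ (N - n * s))) := by
  have hs0 : 0 < s.re := (Nat.cast_nonneg N).trans_lt hs
  have hcc : ∀ r : Fin n, 1 ≤ chainCount Z r := by
    intro r
    unfold chainCount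
    split_ifs <;> omega
  have hexp : ∀ r : Fin n, 0 < ((chainCount Z r : ℂ) * s - rowCount a Z r).re := by
    intro r
    have h1 : (1 : ℝ) ≤ chainCount Z r := by exact_mod_cast hcc r
    have h2 : (rowCount a Z r : ℝ) ≤ N := by exact_mod_cast rowCount_le h r
    simp only [Complex.sub_re, Complex.mul_re, Complex.natCast_re, Complex.natCast_im, zero_mul,
      sub_zero]
    nlinarith
  have hc0 : (chainCount Z j₀ : ℂ) * s - rowCount a Z j₀ = n * s - N := by
    rw [rowCount_zero h h0, chainCount, if_pos (by omega), h0, Nat.sub_zero]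
  obtain ⟨hi, he⟩ := integral_sector_eq Z hInt
  have hm := measurableSet_sectorDomain n
  have hK : ∀ σ ∈ sectorDomain n, (jacobian Z σ : ℂ) * orthantIntegrand a w s (realTmap Z σ) =
      sectorIntegrand a w Z j₀ s σ := fun σ hσ =>
    jacobian_mul_orthantIntegrand w h h0 s fun j => (mem_sectorDomain.1 hσ j).1
  replace hi := hi.congr_fun hK hm
  rw [he, setIntegral_congr_fun hm hK]
  set μ : Fin n → Measure ℝ := fun j =>
    volume.restrict (if (j : ℕ) = 0 then Set.Ioi (0 : ℝ) else Set.Ioo 0 1) with hμ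
  have hμpi : (volume : Measure (Fin n → ℝ)).restrict (sectorDomain n) = Measure.pi μ := by
    rw [sectorDomain, volume_pi, Measure.restrict_pi_pi]
  rw [IntegrableOn, hμpi] at hi
  have hz0 : Function.update (fun j => ((if j = j₀ then 1 else chainCount Z j : ℕ) : ℂ) * (s + l) -
      ((if j = j₀ then 0 else alphav a Z l j : ℕ) : ℂ)) j₀ 1 =
      Function.update (fun r : Fin n => (chainCount Z r : ℂ) * s - rowCount a Z r) j₀ 1 := by
    ext r
    by_cases hr : r = j₀
    · subst hr
      simp
    · rw [Function.update_of_ne hr, Function.update_of_ne hr, if_neg hr, if_neg hr, alphav_eq]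
      push_cast
      ring
  have hG : AnalyticOnNhd ℂ (amplitude a w Z j₀ (N - n * s)) (realCube n) := fun σ hσ =>
    AnalyticAt.comp (g := fun p : ℂ × (Fin n → ℂ) => amplitude a w Z j₀ (N - n * p.1) p.2)
      (f := fun σ => (s, σ))
      (analyticOnNhd_amplitude hH hw Z h0 (e := fun u => N - n * u) (fun u => by fun_prop) (s, σ)
        ⟨Set.mem_univ _, hσ⟩) (by fun_prop)
  have hmul := mul_cubeMellin (z := fun j => ((if j = j₀ then 1 else chainCount Z j : ℕ) : ℂ) *
      (s + l) - ((if j = j₀ then 0 else alphav a Z l j : ℕ) : ℂ)) (fun r => by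
      by_cases hr : r = j₀
      · simp only [if_pos hr]
        simp
        positivity
      · simp only [if_neg hr]
        convert hexp r using 2
        rw [alphav_eq]
        push_cast
        ring) hG j₀
  rw [hz0, pder_eq_zero_of_update_invariant (amplitude_update a w Z h0 _)] at hmul
  simp only [amplitude_update a w Z h0, if_true, Nat.cast_one, one_mul, Nat.cast_zero,
    sub_zero] at hmul
  rw [hmul]
  have hzero : ∀ z : Fin n → ℂ, cubeMellin z 0 = 0 := by
    intro z
    simp [cubeMellin, cubeIntegrand]
  rw [hzero, sub_zero, hμpi, integral_pi_eq_integral_integral_update μ (fun _ => unitMeasure) j₀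
    (fun i hij => by
      rw [hμ, unitMeasure]
      simp only
      rw [if_neg fun e => hij (Fin.ext (e.trans h0.symm))]) hi, cubeMellin, ← integral_const_mul]
  refine integral_congr_ae ?_
  filter_upwards [ae_cubeMeasure n] with x hx
  have hxc : (fun j => (x j : ℂ)) ∈ realCube n :=
    mem_realCube_iff.2 ⟨x, fun j => ⟨(hx j).1.le, (hx j).2.le⟩, rfl⟩
  have hA := linTail_re_pos hw Z h0 hxc
  have hcast : ∀ t : ℝ, (fun j => ((Function.update x j₀ t j : ℝ) : ℂ)) =
      Function.update (fun j => (x j : ℂ)) j₀ (t : ℂ) := by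
    intro t
    ext j
    by_cases hj : j = j₀
    · subst hj
      simp
    · simp [Function.update_of_ne hj]
  have hpt : ∀ t : ℝ, sectorIntegrand a w Z j₀ s (Function.update x j₀ t) =
      ((∏ r ∈ Finset.univ.erase j₀, (x r : ℂ) ^ ((chainCount Z r : ℂ) * s - rowCount a Z r - 1)) *
        (yfun a Z fun j => (x j : ℂ))⁻¹) * ((t : ℂ) ^ ((n : ℂ) * s - N - 1) *
          cexp (-(linTail w Z j₀ (fun j => (x j : ℂ)) * t))) := by
    intro t
    rw [sectorIntegrand, hcast, linTail_update, yfun_update a Z h0, Function.update_self,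
      ← Finset.mul_prod_erase _ _ (Finset.mem_univ j₀), Function.update_self, hc0,
      Finset.prod_congr rfl fun r hr => by rw [Function.update_of_ne (Finset.ne_of_mem_erase hr)]]
    ring
  simp only [hpt]
  have hμ0 : μ j₀ = volume.restrict (Set.Ioi (0 : ℝ)) := by
    simp only [hμ, if_pos h0]
  have hprod : ∏ r ∈ Finset.univ.erase j₀, (x r : ℂ) ^ (Function.update
      (fun r : Fin n => (chainCount Z r : ℂ) * s - rowCount a Z r) j₀ 1 r - 1) =
      ∏ r ∈ Finset.univ.erase j₀, (x r : ℂ) ^ ((chainCount Z r : ℂ) * s - rowCount a Z r - 1) :=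
    Finset.prod_congr rfl fun r hr => by rw [Function.update_of_ne (Finset.ne_of_mem_erase hr)]
  rw [integral_const_mul, hμ0,
    integral_cpow_mul_cexp_neg_mul_Ioi (hc0 ▸ hexp j₀) hA, cubeIntegrand,
    ← Finset.mul_prod_erase _ _ (Finset.mem_univ j₀), Function.update_self, sub_self,
    Complex.cpow_zero, one_mul, hprod, amplitude, neg_sub]
  ring

theorem HypH.comp_perm {N n : ℕ} {a : Fin N → Fin n → ℂ} (hH : HypH a) (γ : Equiv.Perm (Fin n)) :
    HypH fun i j => a i (γ j) := by
  refine ⟨fun i j => hH.1 i (γ j), fun i => ?_⟩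
  obtain ⟨j, hj⟩ := hH.2 i
  exact ⟨γ.symm j, by simpa using hj⟩

theorem orthantIntegrand_comp_symm {N n : ℕ} (a : Fin N → Fin n → ℂ) (w : Fin n → ℂ) (s : ℂ)
    (γ : Equiv.Perm (Fin n)) (u : Fin n → ℝ) :
    orthantIntegrand a w s (u ∘ γ.symm) =
      orthantIntegrand (fun i j => a i (γ j)) (fun j => w (γ j)) s u := by
  unfold orthantIntegrand
  congr 1
  · rw [← Equiv.prod_comp γ]
    simp
  · refine Finset.prod_congr rfl fun i _ => ?_
    rw [← Equiv.sum_comp γ]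
    simp

theorem exists_mem_Fj_comp_perm {N n : ℕ} {a : Fin N → Fin n → ℂ} {Z : ℕ} (hZn : Z < n)
    (hrow : ∀ i, (Finset.univ.filter fun j => a i j = 0).card ≤ Z) (γ : Equiv.Perm (Fin n))
    (i : Fin N) : ∃ j : Fin n, (j : ℕ) ≤ Z ∧ i ∈ Fj (fun i j => a i (γ j)) j := by
  refine exists_mem_Fj hZn i (le_trans (le_of_eq ?_) (hrow i))
  refine Finset.card_equiv γ fun j => ?_
  simp

/-- The Mellin slopes of the sector integrals. -/
def mellinSlope {n : ℕ} (Z : ℕ) (j₀ j : Fin n) : ℕ := if j = j₀ then 1 else chainCount Z j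

/-- The orders of differentiation attached to the sector integrals. -/
def mellinOrder {N n : ℕ} (a : Fin N → Fin n → ℂ) (Z l : ℕ) (j₀ j : Fin n) : ℕ :=
  if j = j₀ then 0 else alphav a Z l j

theorem Gamma_pow_mul_zetaIntegral_eq_sum {N n : ℕ} {a : Fin N → Fin n → ℂ} (hH : HypH a)
    {Z : ℕ} (hZn : Z < n) (hrow : ∀ i, (Finset.univ.filter fun j => a i j = 0).card ≤ Z)
    (l : ℕ) {w : Fin n → ℂ} (hw : ∀ j, 0 < (w j).re) {j₀ : Fin n} (h0 : (j₀ : ℕ) = 0) {s : ℂ}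
    (hs : (N : ℝ) < s.re) :
    Gamma s ^ n * zetaIntegral a s w =
      Gamma (n * s - N) * ((s + l) * ∑ γ ∈ InZset n Z, cubeMellin
        (fun j => (mellinSlope Z j₀ j : ℂ) * (s + l) -
          (mellinOrder (fun i j => a i (γ j)) Z l j₀ j : ℂ))
        (amplitude (fun i j => a i (γ j)) (fun j => w (γ j)) Z j₀ (N - n * s))) := by
  obtain ⟨hi, he⟩ := Gamma_pow_mul_zetaIntegral hH hw hs
  obtain ⟨hi', he'⟩ := integral_orthantMeasure_eq_sum Z hi
  rw [he, he', Finset.mul_sum, Finset.mul_sum]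
  refine Finset.sum_congr rfl fun γ hγ => ?_
  have hγi := hi' γ hγ
  simp only [orthantIntegrand_comp_symm] at hγi ⊢
  exact integral_sector_orthantIntegrand (hH.comp_perm γ) (fun j => hw (γ j))
    (exists_mem_Fj_comp_perm hZn hrow γ) h0 l hs hγi

theorem tendsto_mul_Gamma_sub_natCast (M : ℕ) :
    Filter.Tendsto (fun u : ℂ => u * Gamma (u - M)) (nhdsWithin 0 {0}ᶜ)
      (nhds ((-1) ^ M / (M.factorial : ℂ))) := by
  induction M with
  | zero => simpa using Complex.tendsto_self_mul_Gamma_nhds_zero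
  | succ M ih =>
    have hd : Filter.Tendsto (fun u : ℂ => u - (M + 1 : ℕ)) (nhdsWithin 0 {0}ᶜ)
        (nhds (0 - (M + 1 : ℕ))) :=
      (Continuous.tendsto (by fun_prop) 0).mono_left nhdsWithin_le_nhds
    have hne : (0 : ℂ) - (M + 1 : ℕ) ≠ 0 := by
      rw [zero_sub, neg_ne_zero]
      exact Nat.cast_ne_zero.2 M.succ_ne_zero
    have h := ih.div hd hne
    have hlim : (-1) ^ M / (M.factorial : ℂ) / (0 - (M + 1 : ℕ)) =
        (-1) ^ (M + 1) / ((M + 1).factorial : ℂ) := by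
      have h1 : (M.factorial : ℂ) ≠ 0 := Nat.cast_ne_zero.2 M.factorial_ne_zero
      have h2 : (M : ℂ) + 1 ≠ 0 := Nat.cast_add_one_ne_zero M
      rw [Nat.factorial_succ, zero_sub]
      push_cast
      rw [div_neg, div_div, pow_succ, mul_comm (M.factorial : ℂ)]
      ring
    rw [hlim] at h
    refine h.congr' ?_
    filter_upwards [hd.eventually_ne hne] with u hu
    have hG := Complex.Gamma_add_one _ hu
    have : u - (M + 1 : ℕ) + 1 = u - M := by
      push_cast
      ring
    rw [this] at hG
    simp only [Pi.div_apply]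
    rw [hG]
    field_simp

theorem tendsto_mul_Gamma_mul_sub_natCast {c : ℂ} (hc : c ≠ 0) (M : ℕ) :
    Filter.Tendsto (fun u : ℂ => u * Gamma (c * u - M)) (nhdsWithin 0 {0}ᶜ)
      (nhds (c⁻¹ * ((-1) ^ M / (M.factorial : ℂ)))) := by
  have h1 : Filter.Tendsto (fun u : ℂ => c * u) (nhdsWithin 0 {0}ᶜ) (nhdsWithin 0 {0}ᶜ) := by
    refine tendsto_nhdsWithin_of_tendsto_nhds_of_eventually_within _ ?_ ?_
    · have : Filter.Tendsto (fun u : ℂ => c * u) (nhds 0) (nhds (c * 0)) :=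
        Continuous.tendsto (by fun_prop) 0
      rw [mul_zero] at this
      exact this.mono_left nhdsWithin_le_nhds
    · filter_upwards [self_mem_nhdsWithin] with u hu
      exact mul_ne_zero hc hu
  refine (((tendsto_mul_Gamma_sub_natCast M).comp h1).const_mul c⁻¹).congr fun u => ?_
  simp only [Function.comp_apply]
  rw [← mul_assoc, ← mul_assoc, inv_mul_cancel₀ hc, one_mul]

theorem alphav_le {N n : ℕ} {a : Fin N → Fin n → ℂ} {Z : ℕ}
    (h : ∀ i, ∃ j : Fin n, (j : ℕ) ≤ Z ∧ i ∈ Fj a j) (l : ℕ) (j : Fin n) :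
    alphav a Z l j ≤ n * l + N := by
  rw [alphav_eq]
  refine add_le_add (Nat.mul_le_mul_right l ?_) (rowCount_le h j)
  have := j.isLt
  unfold chainCount
  split_ifs <;> omega

theorem one_le_mellinSlope {n : ℕ} (Z : ℕ) (j₀ j : Fin n) : 1 ≤ mellinSlope Z j₀ j := by
  have := j.isLt
  unfold mellinSlope chainCount
  split_ifs <;> omega

theorem mellinSlope_le {n : ℕ} (Z : ℕ) (j₀ j : Fin n) : mellinSlope Z j₀ j ≤ n := by
  have := j.isLt
  unfold mellinSlope chainCount
  split_ifs <;> omega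

theorem eventuallyEq_of_meromorphicOn {f g : ℂ → ℂ} {U : Set ℂ} (hU : IsPreconnected U)
    (hf : MeromorphicOn f U) (hg : MeromorphicOn g U) {x y : ℂ} (hx : x ∈ U) (hy : y ∈ U)
    (hfg : ∀ᶠ z in nhds x, f z = g z) : f =ᶠ[nhdsWithin y {y}ᶜ] g := by
  have hs : MeromorphicOn (f - g) U := hf.sub hg
  have hx' : meromorphicOrderAt (f - g) x = ⊤ := by
    rw [meromorphicOrderAt_eq_top_iff]
    filter_upwards [hfg.filter_mono nhdsWithin_le_nhds] with z hz
    simp [hz]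
  have hy' : meromorphicOrderAt (f - g) y = ⊤ := by
    by_contra hne
    exact hs.meromorphicOrderAt_ne_top_of_isPreconnected hU hy hx hne hx'
  rw [meromorphicOrderAt_eq_top_iff] at hy'
  filter_upwards [hy'] with z hz
  exact sub_eq_zero.1 hz

theorem residue_identity {N n : ℕ} (hn : 0 < n) {a : Fin N → Fin n → ℂ} (hH : HypH a) {Z : ℕ}
    (hZn : Z < n) (hrow : ∀ i, (Finset.univ.filter fun j => a i j = 0).card ≤ Z) (l : ℕ)
    {w : Fin n → ℂ} (hw : ∀ j, 0 < (w j).re) {F : ℂ → ℂ}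
    (hFagree : ∀ s : ℂ, (N : ℝ) < s.re → F s = zetaIntegral a s w)
    (hFmero : MeromorphicOn F Set.univ) (hFreg : AnalyticAt ℂ F (-(l : ℂ))) {j₀ : Fin n}
    (h0 : (j₀ : ℕ) = 0) :
    ((-1) ^ l / (l.factorial : ℂ)) ^ n * F (-(l : ℂ)) =
      ((n : ℂ)⁻¹ * ((-1) ^ (n * l + N) / ((n * l + N).factorial : ℂ))) *
        ∑ γ ∈ InZset n Z, (∏ j, (mellinSlope Z j₀ j : ℂ)⁻¹) *
          (∏ j, ((mellinOrder (fun i j => a i (γ j)) Z l j₀ j).factorial : ℂ)⁻¹) *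
          mder (mellinOrder (fun i j => a i (γ j)) Z l j₀)
            (amplitude (fun i j => a i (γ j)) (fun j => w (γ j)) Z j₀ ((n * l + N : ℕ) : ℂ)) 0 := by
  have hnC : (n : ℂ) ≠ 0 := Nat.cast_ne_zero.2 hn.ne'
  set δ : ℝ := 1 / (n + 1) with hδ
  have hδ0 : 0 < δ := by positivity
  set G : Equiv.Perm (Fin n) → ℂ → (Fin n → ℂ) → ℂ := fun γ u =>
    amplitude (fun i j => a i (γ j)) (fun j => w (γ j)) Z j₀ (N - n * (u - l)) with hG
  set m : Equiv.Perm (Fin n) → Fin n → ℕ :=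
    fun γ => mellinOrder (fun i j => a i (γ j)) Z l j₀ with hm
  have hex := fun γ => exists_isMellinContinuation hn hδ0 _ (mellinSlope Z j₀)
    (fun j => (m γ j : ℤ))
    (G γ) le_rfl
    (fun j => by
      have : (mellinSlope Z j₀ j : ℝ) ≤ n := by exact_mod_cast mellinSlope_le Z j₀ j
      rw [hδ, mul_one_div, div_lt_one (by positivity)]
      linarith)
    (fun j _ => one_le_mellinSlope Z j₀ j)
    (analyticOnNhd_amplitude (hH.comp_perm γ) (fun j => hw (γ j)) Z h0
      (e := fun u => N - n * (u - l)) fun u => by fun_prop)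
  choose A L hA hlim hL using hex
  have hcard : ∀ γ, (Finset.univ.filter fun j => 0 ≤ (m γ j : ℤ)).card = n := by
    intro γ
    simp
  simp only [hcard] at hlim
  set U : Set ℂ := {u : ℂ | -δ < u.re} with hU
  have hUc : IsPreconnected U := (convex_halfSpace_re_gt (-δ)).isPreconnected
  have hml : ∀ γ j, m γ j ≤ n * l + N := by
    intro γ j
    simp only [hm, mellinOrder]
    split_ifs
    · exact Nat.zero_le _
    · exact alphav_le (exists_mem_Fj_comp_perm hZn hrow γ) l j
  set H₁ : ℂ → ℂ := fun u => Gamma (n * (u - l) - N) * (u * ∑ γ ∈ InZset n Z, A γ u) with hH₁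
  set H₂ : ℂ → ℂ := fun u => Gamma (u - l) ^ n * F (u - l) with hH₂
  have hmer1 : MeromorphicOn H₁ U := by
    intro u hu
    have h1 : MeromorphicAt (fun u : ℂ => Gamma (n * (u - l) - N)) u :=
      (Meromorphic.Gamma _).comp_analyticAt (g := fun u : ℂ => n * (u - l) - N) (by fun_prop)
    have h2 : MeromorphicAt (fun u : ℂ => u) u := analyticAt_id.meromorphicAt
    exact h1.mul (h2.mul (MeromorphicAt.fun_sum fun γ _ => (hA γ).1 u hu))
  have hmer2 : MeromorphicOn H₂ U := by
    intro u _
    have h1 : MeromorphicAt (fun u : ℂ => Gamma (u - l)) u :=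
      (Meromorphic.Gamma _).comp_analyticAt (g := fun u : ℂ => u - l) (by fun_prop)
    have h2 : MeromorphicAt (fun u : ℂ => F (u - l)) u :=
      (hFmero _ (Set.mem_univ _)).comp_analyticAt (g := fun u : ℂ => u - l) (by fun_prop)
    exact (h1.pow n).mul h2
  have hagree : ∀ u : ℂ, ((n * l + N + l : ℕ) : ℝ) < u.re → H₁ u = H₂ u := by
    intro u hu
    push_cast at hu
    have hnl : (0 : ℝ) ≤ n * l := by positivity
    have hl0 : (0 : ℝ) ≤ l := by positivity
    have hN0 : (0 : ℝ) ≤ N := by positivity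
    have hu0 : 0 < u.re := by linarith
    have hs : (N : ℝ) < (u - l).re := by
      simp only [Complex.sub_re, Complex.natCast_re]
      linarith
    simp only [hH₁, hH₂]
    rw [hFagree _ hs, Gamma_pow_mul_zetaIntegral_eq_sum hH hZn hrow l hw h0 hs, sub_add_cancel]
    congr 2
    refine Finset.sum_congr rfl fun γ _ => ?_
    rw [(hA γ).2 u (by linarith) fun j => ?_]
    · simp [hm, hG]
    · have h1 : (1 : ℝ) ≤ mellinSlope Z j₀ j := by exact_mod_cast one_le_mellinSlope Z j₀ j
      have h2 : (m γ j : ℝ) ≤ n * l + N := by exact_mod_cast hml γ j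
      push_cast
      nlinarith
  have hev : H₁ =ᶠ[nhdsWithin 0 {0}ᶜ] H₂ := by
    refine eventuallyEq_of_meromorphicOn hUc hmer1 hmer2
      (x := ((n * l + N + l : ℕ) : ℂ) + 1) ?_ ?_ ?_
    · simp only [hU, Set.mem_ofPred_eq, Complex.add_re, Complex.natCast_re, Complex.one_re]
      have : (0 : ℝ) ≤ ((n * l + N + l : ℕ) : ℝ) := Nat.cast_nonneg _
      linarith
    · simp [hU, hδ0]
    · have ho : IsOpen {u : ℂ | ((n * l + N + l : ℕ) : ℝ) < u.re} :=
        isOpen_lt continuous_const Complex.continuous_re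
      filter_upwards [ho.mem_nhds (by simp)] with u hu
      exact hagree u hu
  have hlim1 : Filter.Tendsto (fun u => u ^ n * H₁ u) (nhdsWithin 0 {0}ᶜ)
      (nhds (((n : ℂ)⁻¹ * ((-1) ^ (n * l + N) / ((n * l + N).factorial : ℂ))) *
        ∑ γ ∈ InZset n Z, L γ)) := by
    refine ((tendsto_mul_Gamma_mul_sub_natCast hnC (n * l + N)).mul
      (tendsto_finsetSum (InZset n Z) fun γ _ => hlim γ)).congr fun u => ?_
    simp only [hH₁]
    rw [← Finset.mul_sum]
    have : (n : ℂ) * u - (n * l + N : ℕ) = n * (u - l) - N := by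
      push_cast
      ring
    rw [this]
    ring
  have hFl : Filter.Tendsto (fun u : ℂ => F (u - l)) (nhdsWithin 0 {0}ᶜ) (nhds (F (-(l : ℂ)))) := by
    have h1 : Filter.Tendsto (fun u : ℂ => u - l) (nhds 0) (nhds (0 - l)) :=
      Continuous.tendsto (by fun_prop) 0
    rw [zero_sub] at h1
    exact (hFreg.continuousAt.tendsto.comp h1).mono_left nhdsWithin_le_nhds
  have hlim2 : Filter.Tendsto (fun u => u ^ n * H₂ u) (nhdsWithin 0 {0}ᶜ)
      (nhds (((-1) ^ l / (l.factorial : ℂ)) ^ n * F (-(l : ℂ)))) := by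
    refine (((tendsto_mul_Gamma_sub_natCast l).pow n).mul hFl).congr fun u => ?_
    simp only [hH₂]
    rw [mul_pow, mul_assoc]
  have huniq := tendsto_nhds_unique hlim2 (hlim1.congr' (hev.mono fun u hu => by rw [hu]))
  rw [huniq]
  congr 1
  refine Finset.sum_congr rfl fun γ _ => ?_
  rw [hL γ (m γ) rfl]
  congr 2
  simp only [hG]
  congr 1
  push_cast
  ring

theorem pder_eq_of_hasDerivAt_update {m : ℕ} {f : (Fin m → ℂ) → ℂ} {σ : Fin m → ℂ} {j : Fin m}
    {d : ℂ} (hf : DifferentiableAt ℂ f σ)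
    (hd : HasDerivAt (fun t => f (Function.update σ j t)) d (σ j)) : pder j f σ = d := by
  have h1 := hasDerivAt_update σ j (σ j)
  have hf' : DifferentiableAt ℂ f (Function.update σ j (σ j)) := by
    rwa [Function.update_eq_self]
  have h2 := hf'.hasFDerivAt.comp_hasDerivAt (σ j) h1
  rw [Function.update_eq_self] at h2
  exact h2.unique hd

theorem gfun_eq {N n : ℕ} (a : Fin N → Fin n → ℂ) (w : Fin n → ℂ) (Z : ℕ) {j₀ : Fin n}
    (h0 : (j₀ : ℕ) = 0) (σ : Fin n → ℂ) :
    gfun a Z w σ = cexp (-(σ j₀ * (linTail w Z j₀ σ - w j₀))) / yfun a Z σ := by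
  have h1 : ∏ j ∈ Finset.univ.filter (fun j : Fin n => 1 ≤ (j : ℕ) ∧ (j : ℕ) ≤ Z),
      cexp (-(w j) * ∏ r ∈ Finset.univ.filter (fun r : Fin n => (r : ℕ) ≤ (j : ℕ)), σ r) =
      ∏ j ∈ Finset.univ.filter (fun j : Fin n => 1 ≤ (j : ℕ) ∧ (j : ℕ) ≤ Z),
        cexp (-(w j * Tmap Z σ j)) := by
    refine Finset.prod_congr rfl fun j hj => ?_
    rw [Tmap, if_pos (Finset.mem_filter.1 hj).2.2, neg_mul]
  have h2 : ∏ j ∈ Finset.univ.filter (fun j : Fin n => Z < (j : ℕ)),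
      cexp (-(w j) * σ j * ∏ r ∈ Finset.univ.filter (fun r : Fin n => (r : ℕ) ≤ Z), σ r) =
      ∏ j ∈ Finset.univ.filter (fun j : Fin n => Z < (j : ℕ)), cexp (-(w j * Tmap Z σ j)) := by
    refine Finset.prod_congr rfl fun j hj => ?_
    rw [Tmap, if_neg (not_le.2 (Finset.mem_filter.1 hj).2), neg_mul, neg_mul, mul_assoc]
  have hdisj : Disjoint (Finset.univ.filter (fun j : Fin n => 1 ≤ (j : ℕ) ∧ (j : ℕ) ≤ Z))
      (Finset.univ.filter (fun j : Fin n => Z < (j : ℕ))) :=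
    Finset.disjoint_filter.2 fun j _ h => not_lt.2 h.2
  have hunion : Finset.univ.filter (fun j : Fin n => 1 ≤ (j : ℕ) ∧ (j : ℕ) ≤ Z) ∪
      Finset.univ.filter (fun j : Fin n => Z < (j : ℕ)) = Finset.univ.erase j₀ := by
    ext j
    simp only [Finset.mem_union, Finset.mem_filter, Finset.mem_univ, true_and, Finset.mem_erase,
      and_true, ne_eq, Fin.ext_iff, h0]
    omega
  have h3 : σ j₀ * (linTail w Z j₀ σ - w j₀) =
      ∑ k ∈ Finset.univ.erase j₀, w k * Tmap Z σ k := by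
    rw [mul_sub, ← sum_mul_Tmap_eq_linTail w Z h0, ← Finset.add_sum_erase _ _ (Finset.mem_univ j₀),
      Tmap_eq_prod_chain Z σ j₀, chain_zero Z h0]
    simp
    ring
  rw [gfun, h1, h2, ← Finset.prod_union hdisj, hunion, h3, ← Finset.sum_neg_distrib,
    Complex.exp_sum]

theorem eventually_yfun_ne_zero {N n : ℕ} {a : Fin N → Fin n → ℂ} (hH : HypH a) (Z : ℕ) :
    ∀ᶠ σ in nhds (0 : Fin n → ℂ), yfun a Z σ ≠ 0 :=
  (contDiff_yfun a Z (k := 0)).continuous.continuousAt.eventually_ne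
    (yfun_ne_zero hH Z (zero_mem_realCube n))

theorem analyticAt_gfun {N n : ℕ} (a : Fin N → Fin n → ℂ) (w : Fin n → ℂ) (Z : ℕ) {j₀ : Fin n}
    (h0 : (j₀ : ℕ) = 0) {σ : Fin n → ℂ} (hσ : yfun a Z σ ≠ 0) : AnalyticAt ℂ (gfun a Z w) σ := by
  rw [funext (gfun_eq a w Z h0)]
  have h1 : AnalyticAt ℂ (fun σ : Fin n → ℂ => σ j₀) σ :=
    (ContinuousLinearMap.proj (R := ℂ) (φ := fun _ : Fin n => ℂ) j₀).analyticAt σ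
  exact (h1.mul ((contDiff_linTail w Z j₀).contDiffAt.analyticAt.sub
    analyticAt_const)).neg.cexp.div (contDiff_yfun a Z).contDiffAt.analyticAt hσ

theorem analyticAt_linTail_sub_pow_mul_gfun {N n : ℕ} (a : Fin N → Fin n → ℂ) (w : Fin n → ℂ)
    (Z : ℕ) {j₀ : Fin n} (h0 : (j₀ : ℕ) = 0) (c : ℂ) (q : ℕ) {σ : Fin n → ℂ}
    (hσ : yfun a Z σ ≠ 0) :
    AnalyticAt ℂ (fun σ => (linTail w Z j₀ σ - c) ^ q * gfun a Z w σ) σ :=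
  (((contDiff_linTail w Z j₀).contDiffAt.analyticAt.sub analyticAt_const).pow q).mul
    (analyticAt_gfun a w Z h0 hσ)

theorem pder_iterate_gfun {N n : ℕ} {a : Fin N → Fin n → ℂ} (hH : HypH a) (w : Fin n → ℂ) (Z : ℕ)
    {j₀ : Fin n} (h0 : (j₀ : ℕ) = 0) (q : ℕ) :
    (pder j₀)^[q] (gfun a Z w) =ᶠ[nhds 0]
      fun σ => (-1) ^ q * ((linTail w Z j₀ σ - w j₀) ^ q * gfun a Z w σ) := by
  induction q with
  | zero => simp
  | succ q ih =>
    rw [Function.iterate_succ_apply']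
    refine (ih.pder j₀).trans ?_
    filter_upwards [eventually_yfun_ne_zero hH Z] with σ hσ
    refine pder_eq_of_hasDerivAt_update (analyticAt_const.mul
      (analyticAt_linTail_sub_pow_mul_gfun a w Z h0 (w j₀) q hσ)).differentiableAt ?_
    simp only [gfun_eq a w Z h0, linTail_update, yfun_update a Z h0, Function.update_self]
    have h := ((((hasDerivAt_id (σ j₀)).mul_const (linTail w Z j₀ σ - w j₀)).neg.cexp.div_const
      (yfun a Z σ)).const_mul ((linTail w Z j₀ σ - w j₀) ^ q)).const_mul ((-1) ^ q)
    refine h.congr_deriv ?_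
    simp only [id, Pi.neg_apply]
    ring

theorem Dq_gfun {N n : ℕ} {a : Fin N → Fin n → ℂ} (hH : HypH a) (w : Fin n → ℂ) (Z l : ℕ)
    {j₀ : Fin n} (h0 : (j₀ : ℕ) = 0) (q : ℕ) :
    Dq a Z l q (gfun a Z w) = (q.factorial : ℂ)⁻¹ *
      (∏ j, ((mellinOrder a Z l j₀ j).factorial : ℂ)⁻¹) * ((-1) ^ q *
        mder (mellinOrder a Z l j₀) (fun σ => (linTail w Z j₀ σ - w j₀) ^ q * gfun a Z w σ) 0) := by
  have hiff : ∀ j : Fin n, (j : ℕ) = 0 ↔ j = j₀ := fun j => by rw [Fin.ext_iff, h0]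
  have hg := analyticAt_gfun a w Z h0 (yfun_ne_zero hH Z (zero_mem_realCube n))
  have hq := analyticAt_linTail_sub_pow_mul_gfun a w Z h0 (w j₀) q
    (yfun_ne_zero hH Z (zero_mem_realCube n))
  have hβ : (fun j : Fin n => if (j : ℕ) = 0 then q else alphav a Z l j) =
      Function.update (mellinOrder a Z l j₀) j₀ q := by
    ext j
    by_cases h : j = j₀
    · subst h
      simp [h0]
    · simp [hiff, h, mellinOrder]
  have hβ' : Function.update (mellinOrder a Z l j₀) j₀ 0 = mellinOrder a Z l j₀ := by
    ext j
    by_cases h : j = j₀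
    · subst h
      simp [mellinOrder]
    · simp [h]
  have hprod : ∏ j ∈ Finset.univ.filter (fun j : Fin n => (j : ℕ) ≠ 0),
      ((alphav a Z l j).factorial : ℂ) = ∏ j, ((mellinOrder a Z l j₀ j).factorial : ℂ) := by
    rw [Finset.prod_filter]
    refine Finset.prod_congr rfl fun j _ => ?_
    by_cases h : j = j₀ <;> simp [hiff, h, mellinOrder]
  have h1 := (mder_update_eventuallyEq_mder_pder_iterate hg (mellinOrder a Z l j₀) j₀ q).eq_of_nhds
  have h2 := ((pder_iterate_gfun hH w Z h0 q).mderList (List.finRange n)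
    (mellinOrder a Z l j₀)).eq_of_nhds
  have h3 := (mderList_sum (Finset.univ : Finset Unit) (fun _ => (-1) ^ q) (fun _ => _)
    (fun _ => hq) (List.finRange n) (mellinOrder a Z l j₀)).eq_of_nhds
  simp only [Finset.univ_unique, Finset.sum_singleton] at h3
  rw [Dq, hβ, hprod, h1, hβ', mder_eq_mderList, h2, h3, mul_inv, Finset.prod_inv_distrib,
    mder_eq_mderList]

theorem sum_Dq_gfun {N n : ℕ} {a : Fin N → Fin n → ℂ} (hH : HypH a) (w : Fin n → ℂ) (Z l M : ℕ)
    {j₀ : Fin n} (h0 : (j₀ : ℕ) = 0) :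
    ∑ q ∈ Finset.range (M + 1), ((-1) ^ q * w j₀ ^ (M - q) / ((M - q).factorial : ℂ)) *
        Dq a Z l q (gfun a Z w) =
      (M.factorial : ℂ)⁻¹ * ((∏ j, ((mellinOrder a Z l j₀ j).factorial : ℂ)⁻¹) *
        mder (mellinOrder a Z l j₀) (amplitude a w Z j₀ (M : ℂ)) 0) := by
  have hy := yfun_ne_zero hH Z (zero_mem_realCube n)
  have han := fun c q => analyticAt_linTail_sub_pow_mul_gfun a w Z h0 c q hy
  set P : (Fin n → ℂ) →L[ℂ] (Fin n → ℂ) := ContinuousLinearMap.pi fun j =>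
    if j = j₀ then 0 else ContinuousLinearMap.proj (R := ℂ) (φ := fun _ : Fin n => ℂ) j with hP
  have hPu : ∀ σ, P σ = Function.update σ j₀ 0 := by
    intro σ
    ext j
    by_cases h : j = j₀
    · subst h
      simp [hP]
    · simp [hP, h]
  have hamp : amplitude a w Z j₀ (M : ℂ) =
      fun σ => (fun σ => (linTail w Z j₀ σ - 0) ^ M * gfun a Z w σ) (P σ) := by
    ext σ
    simp only [hPu, gfun_eq a w Z h0, linTail_update, yfun_update a Z h0, Function.update_self,
      amplitude, Complex.cpow_natCast, zero_mul, neg_zero, Complex.exp_zero, sub_zero,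
      mul_one_div]
  have h1 := (mderList_comp_clm P (x := 0) (map_zero P) _ (han 0 M) (List.finRange n)
    (mellinOrder a Z l j₀) fun i hi => by
      have hij : i ≠ j₀ := by
        rintro rfl
        simp [mellinOrder] at hi
      rw [hPu]
      exact Function.update_eq_self_iff.2 (by simp [Ne.symm hij])).eq_of_nhds
  rw [map_zero, ← hamp] at h1
  have hbin : (fun σ => (linTail w Z j₀ σ - 0) ^ M * gfun a Z w σ) = fun σ =>
      ∑ q ∈ Finset.range (M + 1), (w j₀ ^ (M - q) * (M.choose q : ℂ)) *
        ((linTail w Z j₀ σ - w j₀) ^ q * gfun a Z w σ) := by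
    ext σ
    have := add_pow (linTail w Z j₀ σ - w j₀) (w j₀) M
    rw [sub_add_cancel] at this
    rw [sub_zero, this, Finset.sum_mul]
    refine Finset.sum_congr rfl fun q _ => ?_
    ring
  have h2 := (mderList_sum (Finset.range (M + 1)) (fun q => w j₀ ^ (M - q) * (M.choose q : ℂ)) _
    (fun q => han (w j₀) q) (List.finRange n) (mellinOrder a Z l j₀)).eq_of_nhds
  rw [mder_eq_mderList, h1, hbin, h2, Finset.mul_sum, Finset.mul_sum]
  refine Finset.sum_congr rfl fun q hq => ?_
  rw [Dq_gfun hH w Z l h0, mder_eq_mderList,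
    Nat.cast_choose ℂ (Nat.lt_succ_iff.1 (Finset.mem_range.1 hq))]
  have hM : (M.factorial : ℂ) ≠ 0 := Nat.cast_ne_zero.2 M.factorial_ne_zero
  have hs : ((-1 : ℂ) ^ q) * (-1) ^ q = 1 := by rw [← mul_pow]; simp
  rw [show (M.factorial : ℂ)⁻¹ * ((∏ j, ((mellinOrder a Z l j₀ j).factorial : ℂ)⁻¹) *
      (w j₀ ^ (M - q) * ((M.factorial : ℂ) / (q.factorial * (M - q).factorial)) *
        mderList (List.finRange n) (mellinOrder a Z l j₀)
          (fun σ => (linTail w Z j₀ σ - w j₀) ^ q * gfun a Z w σ) 0)) =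
      ((M.factorial : ℂ)⁻¹ * M.factorial) * ((∏ j, ((mellinOrder a Z l j₀ j).factorial : ℂ)⁻¹) *
      (w j₀ ^ (M - q) * ((q.factorial : ℂ)⁻¹ * ((M - q).factorial : ℂ)⁻¹) *
        mderList (List.finRange n) (mellinOrder a Z l j₀)
          (fun σ => (linTail w Z j₀ σ - w j₀) ^ q * gfun a Z w σ) 0)) by ring, inv_mul_cancel₀ hM]
  linear_combination (w j₀ ^ (M - q) * ((q.factorial : ℂ)⁻¹ * ((M - q).factorial : ℂ)⁻¹) *
    ((∏ j, ((mellinOrder a Z l j₀ j).factorial : ℂ)⁻¹) *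
      mderList (List.finRange n) (mellinOrder a Z l j₀)
        (fun σ => (linTail w Z j₀ σ - w j₀) ^ q * gfun a Z w σ) 0)) * hs

theorem mul_prod_mellinSlope {n : ℕ} (hn : 0 < n) {Z : ℕ} (hZn : Z < n) :
    (n : ℂ) * ∏ j : Fin n, (mellinSlope Z ⟨0, hn⟩ j : ℂ) =
      ∏ j ∈ Finset.range (Z + 1), ((n : ℂ) - (j : ℂ)) := by
  have h1 : ∏ j : Fin n, (mellinSlope Z ⟨0, hn⟩ j : ℂ) =
      ∏ j ∈ Finset.range n, if j ≠ 0 ∧ j ≤ Z then (n : ℂ) - (j : ℂ) else 1 := by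
    rw [← Fin.prod_univ_eq_prod_range (fun j => if j ≠ 0 ∧ j ≤ Z then (n : ℂ) - (j : ℂ) else 1)]
    refine Finset.prod_congr rfl fun j _ => ?_
    by_cases h : (j : ℕ) = 0
    · simp [mellinSlope, Fin.ext_iff, h]
    · by_cases h' : (j : ℕ) ≤ Z
      · simp [mellinSlope, chainCount, Fin.ext_iff, h, h', Nat.cast_sub j.2.le]
      · simp [mellinSlope, chainCount, Fin.ext_iff, h, h']
  rw [h1, ← Finset.prod_subset (Finset.range_mono (Nat.succ_le_of_lt hZn)) fun j _ hj => ?_,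
    Finset.prod_range_succ', Finset.prod_range_succ']
  · simp only [ne_eq, not_true_eq_false, false_and, if_false, mul_one, Nat.cast_zero, sub_zero,
      mul_comm _ (n : ℂ)]
    congr 1
    refine Finset.prod_congr rfl fun j hj => if_pos ⟨by omega, ?_⟩
    exact Finset.mem_range.1 hj
  · rw [if_neg]
    rintro ⟨_, h⟩
    exact hj (Finset.mem_range.2 (by omega))

/-- Theorem 2 (integral case): the special value `𝒵_{N,n}(-ℓ,w,M)` of the analytic
continuation of the zeta integral is given by the explicit finite-Taylor formula. -/
theorem zetaIntegral_special_value {N n : ℕ} (hN : 0 < N) (hn : 0 < n)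
    (a : Fin N → Fin n → ℂ) (hH : HypH a) (Z : ℕ) (hZn : Z < n)
    (hrow : ∀ i, ((Finset.univ.filter fun j => a i j = 0).card ≤ Z))
    (l : ℕ) (w : Fin n → ℂ) (hw : ∀ j, 0 < (w j).re)
    (F : ℂ → ℂ) (hFagree : ∀ s : ℂ, (N : ℝ) < s.re → F s = zetaIntegral a s w)
    (hFmero : MeromorphicOn F Set.univ) (hFreg : AnalyticAt ℂ F (-(l : ℂ))) :
    F (-(l : ℂ)) =
      ((-1 : ℂ) ^ N * ((l.factorial : ℂ)) ^ n / ∏ j ∈ Finset.range (Z + 1), ((n : ℂ) - (j : ℂ))) *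
        ∑ γ ∈ InZset n Z, ∑ q ∈ Finset.range (n * l + N + 1),
          ((-1 : ℂ) ^ q * (w (γ ⟨0, hn⟩)) ^ (n * l + N - q) / ((n * l + N - q).factorial : ℂ)) *
            Dq (fun i j => a i (γ j)) Z l q
              (gfun (fun i j => a i (γ j)) Z (fun j => w (γ j))) := by
  have hres := residue_identity hn hH hZn hrow l hw hFagree hFmero hFreg (j₀ := ⟨0, hn⟩) rfl
  have hsum := fun γ : Equiv.Perm (Fin n) =>
    sum_Dq_gfun (hH.comp_perm γ) (fun j => w (γ j)) Z l (n * l + N) (j₀ := ⟨0, hn⟩) rfl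
  have hsign : ((-1 : ℂ) ^ l) ^ n * (-1) ^ (n * l + N) = (-1) ^ N := by
    rw [pow_add, mul_comm n l, pow_mul, ← mul_assoc, ← mul_pow, ← mul_pow]
    simp
  have hunit : ((-1 : ℂ) ^ l) ^ n * ((-1) ^ l) ^ n = 1 := by
    rw [← mul_pow, ← mul_pow]
    simp
  have hl : (l.factorial : ℂ) ^ n ≠ 0 := pow_ne_zero _ (Nat.cast_ne_zero.2 l.factorial_ne_zero)
  simp only [hsum]
  rw [← mul_prod_mellinSlope hn hZn, ← Finset.mul_sum, div_eq_mul_inv, mul_inv,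
    ← Finset.prod_inv_distrib]
  have hF : F (-(l : ℂ)) = ((-1) ^ l) ^ n * (l.factorial : ℂ) ^ n *
      (((-1) ^ l / (l.factorial : ℂ)) ^ n * F (-(l : ℂ))) := by
    rw [div_pow]
    field_simp
    rw [sq, hunit]
    simp
  rw [hF, hres, ← hsign]
  simp only [mul_assoc, ← Finset.mul_sum]
  ring
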